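/- arXiv:0803.3395 — 10 statements merged into one kernel-verified Lean document; each statement's English description precedes it below -/
import Mathlib

section
/- Let G be a group, θ an involutive automorphism of G, H := {g ∈ G | θ(g) = g} its fixed-point subgroup, and define σ : G → G by σ(g) := θ(g)⁻¹. Suppose g' ∈ G and h₁, h₂ ∈ H satisfy σ(g') = h₁ · g' · h₂. Then the element g := g' · h₁ is normal, i.e. σ(g) · g = g · σ(g). -/
/-- if `σ(g') = h₁ g' h₂` with `h₁, h₂` fixed by `θ`,
then `g := g' h₁` is normal, i.e. `σ(g) g = g σ(g)`. -/
theorem stmt_0 {G : Type*} [Group G] (θ : G →* G)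
    (hθ : ∀ g, θ (θ g) = g)
    (σ : G → G) (hσ : ∀ g, σ g = (θ g)⁻¹)
    (g' h₁ h₂ : G) (hh₁ : θ h₁ = h₁) (hh₂ : θ h₂ = h₂)
    (h : σ g' = h₁ * g' * h₂) :
    σ (g' * h₁) * (g' * h₁) = (g' * h₁) * σ (g' * h₁) := by
  rw [hσ] at h
  have hswap : (θ g')⁻¹ = h₂ * g' * h₁ := by
    have h' := congrArg θ h
    simp only [map_inv, map_mul, hθ, hh₁, hh₂] at h'
    have hθg : θ g' = h₁⁻¹ * g'⁻¹ * h₂⁻¹ := by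
      rw [h']
      group
    rw [hθg]
    group
  have hσg : σ (g' * h₁) = g' * h₂ := by
    rw [hσ, map_mul, hh₁, mul_inv_rev, h]
    group
  have hcomm : h₂ * g' * h₁ = h₁ * g' * h₂ := hswap.symm.trans h
  rw [hσg]
  simpa only [mul_assoc] using congrArg (g' * ·) hcomm
end

section
/- Let G be a group, θ an involutive automorphism of G, H := {g ∈ G | θ(g) = g}, σ(g) := θ(g)⁻¹, and s(g) := g·σ(g). Fix g ∈ G. Then the map (h₁, h₂) ↦ h₁ is a group isomorphism from the stabilizer {(h₁, h₂) ∈ H × H | h₁ · g · h₂⁻¹ = g} of g under the two-sided action of H × H onto the centralizer {h ∈ H | h · s(g) = s(g) · h} of s(g) in H. -/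
/-- the first projection is a group isomorphism from the stabilizer
of `g` under the two-sided action of `H × H` onto the centralizer of `s(g) = g σ(g)`
in `H`. -/
theorem stmt_2 {G : Type*} [Group G] (θ : G →* G)
    (hθ : ∀ g, θ (θ g) = g)
    (g : G)
    (S : Subgroup (G × G))
    (hS : ∀ p : G × G, p ∈ S ↔ θ p.1 = p.1 ∧ θ p.2 = p.2 ∧ p.1 * g * p.2⁻¹ = g)
    (C : Subgroup G)
    (hC : ∀ h : G, h ∈ C ↔ θ h = h ∧ h * (g * (θ g)⁻¹) = (g * (θ g)⁻¹) * h) :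
    ∃ e : S ≃* C, ∀ p : S, (e p : G) = (p : G × G).1 := by
  have key (p : G × G) : p ∈ S ↔ p.1 ∈ C ∧ p.2 = g⁻¹ * p.1 * g := by
    have hp : p.1 * g * p.2⁻¹ = g ↔ p.2 = g⁻¹ * p.1 * g := by
      rw [mul_inv_eq_iff_eq_mul, mul_assoc, eq_inv_mul_iff_mul_eq, eq_comm]
    have hs : p.1 * (g * (θ g)⁻¹) = g * (θ g)⁻¹ * p.1 ↔
        (θ g)⁻¹ * p.1 * θ g = g⁻¹ * p.1 * g := by
      rw [← mul_assoc, mul_inv_eq_iff_eq_mul, mul_assoc g⁻¹, eq_inv_mul_iff_mul_eq, eq_comm]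
      simp only [mul_assoc]
    rw [hS, hC, hp, hs]
    constructor
    · rintro ⟨h₁, h₂, h⟩
      refine ⟨⟨h₁, ?_⟩, h⟩
      rw [← h, ← h₂, h]
      simp [h₁]
    · rintro ⟨⟨h₁, h₂⟩, h⟩
      refine ⟨h₁, ?_, h⟩
      rw [h, ← h₂]
      simp [h₁, h₂]
  exact ⟨{
    toFun p := ⟨p.1.1, ((key p).1 p.2).1⟩
    invFun h := ⟨(h, g⁻¹ * h * g), (key _).2 ⟨h.2, rfl⟩⟩
    left_inv p := Subtype.ext (Prod.ext rfl ((key p).1 p.2).2.symm)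
    right_inv _ := rfl
    map_mul' _ _ := rfl }, fun _ => rfl⟩
end

section
/- Let g be a finite-dimensional semisimple Lie algebra over a field k of characteristic zero, let θ be an involutive Lie algebra automorphism of g, and let x ∈ g be a nilpotent element (i.e. ad(x) is a nilpotent endomorphism) with θ(x) = −x. Then there exist h, y ∈ g with θ(h) = h and θ(y) = −y such that (e,h,f) := (x, h, y) is an sl2 triple, i.e. [h, x] = 2x, [h, y] = −2y, and [x, y] = h. -/
/-- If `C = AB - BA` commutes with the nilpotent element `A`, then `C` is nilpotent
(a form of the Kleinecke–Shirokov theorem). -/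
theorem isNilpotent_commutator_of_commute {k R : Type*} [Field k] [CharZero k] [Ring R]
    [Algebra k R] {A B C : R} (hA : IsNilpotent A) (hC : A * B - B * A = C) (hAC : Commute A C) :
    IsNilpotent C := by
  set D : Module.End k R := LinearMap.mulLeft k A - LinearMap.mulRight k A
  have hDapp (X : R) : D X = A * X - X * A := rfl
  have hDnil : IsNilpotent D := by
    refine (LinearMap.commute_mulLeft_right A A).isNilpotent_sub ?_ ?_
    · rwa [LinearMap.isNilpotent_mulLeft_iff]
    · rwa [LinearMap.isNilpotent_mulRight_iff]
  have hDC (X : R) : D (C * X) = C * D X := by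
    rw [hDapp, hDapp, mul_sub, ← mul_assoc, hAC.eq]
    simp only [mul_assoc]
  have hDB (X : R) : D (B * X) = B * D X + C * X := by
    rw [hDapp, hDapp, ← hC]
    noncomm_ring
  have leibniz (m : ℕ) (X : R) :
      (D ^ (m + 1)) (B * X) = B * (D ^ (m + 1)) X + (m + 1 : k) • (C * (D ^ m) X) := by
    induction m with
    | zero => simp [hDB]
    | succ m ih =>
      rw [pow_succ', Module.End.mul_apply, ih, map_add, map_smul, hDB, hDC,
        ← Module.End.mul_apply, ← pow_succ', ← Module.End.mul_apply, ← pow_succ']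
      push_cast
      module
  have hpow (n : ℕ) : (D ^ n) (B ^ n) = (n.factorial : k) • C ^ n := by
    induction n with
    | zero => simp
    | succ n ih =>
      have hCn : D (C ^ n) = 0 := by rw [hDapp, (hAC.pow_right n).eq, sub_self]
      rw [pow_succ' B, leibniz, pow_succ' D, Module.End.mul_apply, ih, map_smul, hCn,
        smul_zero, mul_zero, zero_add, mul_smul_comm, ← pow_succ', smul_smul, Nat.factorial_succ]
      push_cast
      rfl
  obtain ⟨n, hn⟩ := hDnil
  refine ⟨n, ?_⟩
  have := hpow n
  rw [hn, LinearMap.zero_apply, eq_comm, smul_eq_zero] at this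
  exact this.resolve_left (mod_cast n.factorial_ne_zero)

/-- If `AB - BA` commutes with the nilpotent element `A`, then `AB` is nilpotent. -/
theorem isNilpotent_mul_of_commute_commutator (k : Type*) {R : Type*} [Field k] [CharZero k]
    [Ring R] [Algebra k R] {A B C : R} (hA : IsNilpotent A) (hC : A * B - B * A = C)
    (hAC : Commute A C) : IsNilpotent (A * B) := by
  obtain ⟨N, hN⟩ := isNilpotent_commutator_of_commute (k := k) hA hC hAC
  have hBA : B * A = A * B - C := by rw [← hC, sub_sub_cancel]
  have hBpow (n : ℕ) : A * B * A ^ n = A ^ (n + 1) * B - n • (A ^ n * C) := by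
    induction n with
    | zero => simp
    | succ n ih =>
      rw [pow_succ, ← mul_assoc, ih, sub_mul, mul_assoc _ B, hBA, mul_sub, smul_mul_assoc,
        mul_assoc _ C, ← hAC.eq, succ_nsmul]
      simp only [← mul_assoc, ← pow_succ]
      abel
  have hstep (n j : ℕ) : ∃ Y, (A * B) ^ j * A ^ n = (-n : ℤ) ^ j • (A ^ n * C ^ j) +
      A ^ (n + 1) * Y := by
    induction j with
    | zero => exact ⟨0, by simp⟩
    | succ j ih =>
      obtain ⟨Y, hY⟩ := ih
      refine ⟨(-n : ℤ) ^ j • (B * C ^ j) + (A * B - (n + 1) • C) * Y, ?_⟩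
      rw [pow_succ', mul_assoc, hY, mul_add, mul_smul_comm, ← mul_assoc, ← mul_assoc, hBpow,
        hBpow, pow_succ' C, pow_succ' (-n : ℤ), mul_comm (-n : ℤ), mul_smul, neg_smul,
        pow_succ A (n + 1)]
      simp only [sub_mul, mul_sub, mul_add, smul_sub, smul_mul_assoc, mul_smul_comm, mul_assoc,
        natCast_zsmul, smul_neg]
      abel
  have hmul (n : ℕ) : ∃ Y, (A * B) ^ (N * n) = A ^ n * Y := by
    induction n with
    | zero => exact ⟨1, by simp⟩
    | succ n ih =>
      obtain ⟨Y, hY⟩ := ih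
      obtain ⟨Z, hZ⟩ := hstep n N
      rw [hN, mul_zero, smul_zero, zero_add] at hZ
      exact ⟨Z * Y, by rw [mul_add_one, add_comm, pow_add, hY, ← mul_assoc, hZ, mul_assoc]⟩
  obtain ⟨m, hm⟩ := hA
  obtain ⟨Y, hY⟩ := hmul m
  exact ⟨N * m, by rw [hY, hm, zero_mul]⟩

/-- If `H = [A, B]` satisfies `[H, A] = 2A`, then
`A ^ (n + 1) B - B A ^ (n + 1) = (n + 1) (H - n) A ^ n`. -/
theorem pow_succ_mul_sub_mul_pow_succ {R : Type*} [Ring R] {A B H : R}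
    (hH : A * B - B * A = H) (hHA : H * A - A * H = 2 * A) (n : ℕ) :
    A ^ (n + 1) * B - B * A ^ (n + 1) = (n + 1) * ((H - n) * A ^ n) := by
  have hAH : A * H = H * A - 2 * A := by rw [← hHA, sub_sub_cancel]
  have hAB : A * B = B * A + H := by rw [← hH, add_sub_cancel]
  induction n with
  | zero => simpa using hH
  | succ n ih =>
    have key : A ^ (n + 1 + 1) * B - B * A ^ (n + 1 + 1) =
        A * (A ^ (n + 1) * B - B * A ^ (n + 1)) + (A * B - B * A) * A ^ (n + 1) := by
      rw [pow_succ' A (n + 1)]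
      noncomm_ring
    have comm (X : R) : A * ((n + 1) * X) = (n + 1) * (A * X) := by
      rw [← mul_assoc, ← mul_assoc, mul_add_one, add_one_mul, (Nat.cast_commute n A).eq]
    rw [key, ih, hH, comm, ← mul_assoc A, mul_sub, hAH, ← (Nat.cast_commute n A).eq,
      pow_succ' A n]
    push_cast
    noncomm_ring

/-- If `H = [A, B]` and `[H, A] = 2A` with `A` nilpotent, then `-2` is not an
eigenvalue of `H` on the kernel of `A`. -/
theorem eq_zero_of_mem_ker_of_apply_eq_neg_two_smul {k V : Type*} [Field k] [CharZero k]
    [AddCommGroup V] [Module k V] {A B H : Module.End k V} (hA : IsNilpotent A)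
    (hH : A * B - B * A = H) (hHA : H * A - A * H = 2 * A) {z : V} (hz : A z = 0)
    (hHz : H z = (-2 : k) • z) : z = 0 := by
  have hrange (n : ℕ) : ∃ v, z = (A ^ n) v := by
    induction n with
    | zero => exact ⟨z, by simp⟩
    | succ n ih =>
      obtain ⟨v, hv⟩ := ih
      have h := congrArg (· v) (pow_succ_mul_sub_mul_pow_succ hH hHA n)
      have hAv : (A ^ (n + 1)) v = 0 := by rw [pow_succ', Module.End.mul_apply, ← hv, hz]
      have hcoef : ((n : k) + 1) * (-2 - n) ≠ 0 := by
        rw [← neg_add', mul_neg, neg_ne_zero]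
        norm_cast
        positivity
      refine ⟨(((n : k) + 1) * (-2 - n))⁻¹ • B v, ?_⟩
      rw [map_smul, eq_inv_smul_iff₀ hcoef]
      simp only [LinearMap.sub_apply, Module.End.mul_apply, LinearMap.add_apply, hAv, map_zero,
        ← hv, hHz, Module.End.one_apply, Module.End.natCast_apply, sub_zero] at h
      rw [h]
      module
  obtain ⟨m, hm⟩ := hA
  obtain ⟨v, hv⟩ := hrange m
  rw [hv, hm, LinearMap.zero_apply]

namespace LieAlgebra

variable {k L : Type*} [Field k] [LieRing L] [LieAlgebra k L]

theorem ad_mul_ad_sub (a b : L) :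
    ad k L a * ad k L b - ad k L b * ad k L a = ad k L ⁅a, b⁆ := by
  ext c
  simp

/-- In a Lie algebra with nondegenerate Killing form, an ad-nilpotent element `x` lies in the
range of `(ad x) ^ 2`. -/
theorem exists_lie_lie_eq_of_isNilpotent_ad [CharZero k] [Module.Finite k L]
    [IsKilling k L] {x : L}
    (hx : IsNilpotent (ad k L x)) : ∃ w, ⁅x, ⁅x, w⁆⁆ = x := by
  set W := LinearMap.range (ad k L x * ad k L x)
  suffices x ∈ W from this
  rw [← LinearMap.BilinForm.orthogonal_orthogonal (IsKilling.killingForm_nondegenerate k L)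
    (LieModule.traceForm_isSymm k L L).isRefl W]
  intro z hz
  have hker : ⁅x, ⁅x, z⁆⁆ = 0 := by
    refine (IsKilling.killingForm_nondegenerate k L).2 _ fun v ↦ ?_
    have hv : killingForm k L ⁅x, ⁅x, v⁆⁆ z = 0 := hz _ ⟨v, rfl⟩
    rwa [LieModule.traceForm_apply_lie_apply', LieModule.traceForm_apply_lie_apply',
      neg_neg] at hv
  have hcomm : Commute (ad k L x) (ad k L ⁅x, z⁆) := by
    rw [Commute, SemiconjBy, ← sub_eq_zero, ad_mul_ad_sub, hker, map_zero]
  have := isNilpotent_mul_of_commute_commutator k hx (ad_mul_ad_sub x z) hcomm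
  change killingForm k L z x = 0
  rw [LieModule.traceForm_comm]
  exact (LinearMap.isNilpotent_trace_of_isNilpotent this).eq_zero

end LieAlgebra


/-- a nilpotent `x` with `θ x = -x` in a finite-dimensional semisimple
Lie algebra over a field of characteristic zero can be completed to an sl2 triple
`(x, h, y)` with `θ h = h` and `θ y = -y`. -/
theorem stmt_5 {k : Type*} [Field k] [CharZero k]
    {L : Type*} [LieRing L] [LieAlgebra k L] [Module.Finite k L]
    [LieAlgebra.IsSemisimple k L]
    (θ : L →ₗ⁅k⁆ L) (hθ : ∀ a, θ (θ a) = a)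
    (x : L) (hnil : IsNilpotent (LieAlgebra.ad k L x)) (hx : θ x = -x) :
    ∃ h y : L, θ h = h ∧ θ y = -y ∧
      ⁅h, x⁆ = (2 : k) • x ∧ ⁅h, y⁆ = (-2 : k) • y ∧ ⁅x, y⁆ = h := by
  obtain ⟨v, hv⟩ := LieAlgebra.exists_lie_lie_eq_of_isNilpotent_ad hnil
  have hθv : ⁅x, ⁅x, θ v⁆⁆ = -x := by
    have := congrArg θ hv
    simpa only [LieHom.map_lie, hx, neg_lie, lie_neg, neg_neg] using this
  obtain ⟨w, hw⟩ : ∃ w, w = θ v - v := ⟨_, rfl⟩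
  have hθw : θ w = -w := by simp [hw, hθ]
  obtain ⟨h, hh⟩ : ∃ h, h = ⁅x, w⁆ := ⟨_, rfl⟩
  have hθh : θ h = h := by simp [hh, hx, hθw]
  have hxh : ⁅x, h⁆ = (-2 : k) • x := by
    rw [hh, hw, lie_sub, lie_sub, hθv, hv]
    module
  have hhx : ⁅h, x⁆ = (2 : k) • x := by
    rw [← lie_skew, hxh]
    module
  have hcomm (z : L) : ⁅x, ⁅h, z⁆⁆ = ⁅h, ⁅x, z⁆⁆ - (2 : k) • ⁅x, z⁆ := by
    rw [leibniz_lie, hxh, smul_lie]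
    module
  set K := LinearMap.ker (LieAlgebra.ad k L x)
  have hmem (z : L) : z ∈ K ↔ ⁅x, z⁆ = 0 := LinearMap.mem_ker
  obtain ⟨T, hT⟩ : ∃ T : Module.End k L, ∀ z, T z = ⁅h, z⁆ + (2 : k) • z :=
    ⟨LieAlgebra.ad k L h + (2 : k) • 1, fun _ ↦ rfl⟩
  have hTK : ∀ z ∈ K, T z ∈ K := by
    intro z hz
    rw [hmem] at hz ⊢
    simp [hT, hcomm, hz]
  have hinj : Function.Injective (T.restrict hTK) := by
    rw [injective_iff_map_eq_zero]
    rintro ⟨z, hz⟩ hzT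
    have hTz : ⁅h, z⁆ + (2 : k) • z = 0 := by
      rw [← hT]
      exact congrArg Subtype.val hzT
    refine Subtype.ext (eq_zero_of_mem_ker_of_apply_eq_neg_two_smul (k := k) hnil
      (LieAlgebra.ad_mul_ad_sub x w) ?_ hz ?_)
    · rw [LieAlgebra.ad_mul_ad_sub, ← hh, hhx, map_smul, two_smul, two_mul]
    · rw [LieAlgebra.ad_apply, ← hh, eq_neg_of_add_eq_zero_left hTz, neg_smul]
  have hwK : T w ∈ K := by
    rw [hmem, hT, lie_add, hcomm, lie_smul, ← hh, lie_self]
    module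
  obtain ⟨⟨u, hu⟩, huT⟩ := LinearMap.injective_iff_surjective.mp hinj ⟨T w, hwK⟩
  have huT : T u = T w := congrArg Subtype.val huT
  rw [hmem] at hu
  have hTθ (z : L) : T (θ z) = θ (T z) := by simp [hT, hθh]
  have hxu : ⁅x, θ u⁆ = 0 := by
    have := congrArg θ hu
    simpa only [LieHom.map_lie, hx, neg_lie, map_zero, neg_eq_zero] using this
  obtain ⟨y, hy⟩ : ∃ y, y = w - (2⁻¹ : k) • (u - θ u) := ⟨_, rfl⟩
  have hTy : T y = 0 := by
    rw [hy, map_sub, map_smul, map_sub, hTθ, huT, ← hTθ, hθw, map_neg]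
    module
  refine ⟨h, y, hθh, ?_, hhx, ?_, ?_⟩
  · simp only [hy, map_sub, map_smul, hθw, hθ]
    module
  · rw [hT] at hTy
    rw [eq_neg_of_add_eq_zero_left hTy, neg_smul]
  · simp [hy, hu, hxu, ← hh]
end

section
/- Let k be a field of characteristic zero, L a Lie algebra over k containing an sl2 triple (e, h, f), and V a finite-dimensional L-module. Let ρ denote the action map. Since ρ(h) maps the subspace ρ(e)(V) into itself, ρ(h) induces an endomorphism of the quotient space V / ρ(e)(V). Then every eigenvalue of this induced endomorphism is a non-positive integer, i.e. of the form (−n : k) for some natural number n. -/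
/-- An eigenvalue of the endomorphism induced on the quotient by an invariant subspace `p` is
also an eigenvalue of the transpose, with an eigenvector vanishing on `p`. -/
theorem exists_dual_eigenvector_of_quotient_eigenvector {k V : Type*} [Field k] [AddCommGroup V]
    [Module k V] [Module.Finite k V] (T : Module.End k V) (p : Submodule k V)
    (hp : ∀ w ∈ p, T w ∈ p) {μ : k} {v : V} (hv : v ∉ p) (hTv : T v - μ • v ∈ p) :
    ∃ φ : V →ₗ[k] k, φ ≠ 0 ∧ (∀ w ∈ p, φ w = 0) ∧ ∀ w, φ (T w) = μ * φ w := by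
  have hle : p ≤ p.comap (T - μ • LinearMap.id) := fun w hw ↦
    p.sub_mem (hp w hw) (p.smul_mem μ hw)
  let S : Module.End k (V ⧸ p) := p.mapQ p (T - μ • LinearMap.id) hle
  have hS (w : V) : S (p.mkQ w) = p.mkQ (T w - μ • w) := rfl
  have hker : p.mkQ v ∈ LinearMap.ker S := by
    rw [LinearMap.mem_ker, hS]
    exact (Submodule.Quotient.mk_eq_zero p).2 hTv
  have hrange : LinearMap.range S ≠ ⊤ := by
    intro htop
    rw [LinearMap.ker_eq_bot_iff_range_eq_top.2 htop, Submodule.mem_bot] at hker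
    exact hv ((Submodule.Quotient.mk_eq_zero p).1 hker)
  obtain ⟨ψ, hψ, hψS⟩ := Submodule.exists_le_ker_of_lt_top _ hrange.lt_top
  refine ⟨ψ ∘ₗ p.mkQ, fun h0 ↦ hψ ?_, fun w hw ↦ ?_, fun w ↦ ?_⟩
  · exact LinearMap.ext fun x ↦ by
      obtain ⟨w, rfl⟩ := p.mkQ_surjective x
      exact LinearMap.congr_fun h0 w
  · rw [LinearMap.comp_apply, show p.mkQ w = 0 from (Submodule.Quotient.mk_eq_zero p).2 hw,
      map_zero]
  · have hw : ψ (S (p.mkQ w)) = 0 := hψS ⟨_, rfl⟩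
    rw [hS, map_sub, map_sub, map_smul, map_smul, smul_eq_mul, sub_eq_zero] at hw
    exact hw


/-- for an sl2 triple `(e, h, f)` in a Lie algebra `L` over a field of
characteristic zero and a finite-dimensional `L`-module `V`, the action of `h`
preserves the subspace `ρ(e)(V)`, and every eigenvalue of the endomorphism induced
by `ρ(h)` on `V / ρ(e)(V)` is a non-positive integer. -/
theorem stmt_6 {k : Type*} [Field k] [CharZero k]
    {L : Type*} [LieRing L] [LieAlgebra k L]
    (e h f : L) (he : ⁅h, e⁆ = (2 : k) • e) (hf : ⁅h, f⁆ = (-2 : k) • f)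
    (hef : ⁅e, f⁆ = h)
    {V : Type*} [AddCommGroup V] [Module k V] [LieRingModule L V] [LieModule k L V]
    [Module.Finite k V] :
    (∀ w ∈ LinearMap.range (LieModule.toEnd k L V e),
      ⁅h, w⁆ ∈ LinearMap.range (LieModule.toEnd k L V e)) ∧
    (∀ μ : k, (∃ v : V, v ∉ LinearMap.range (LieModule.toEnd k L V e) ∧
        ⁅h, v⁆ - μ • v ∈ LinearMap.range (LieModule.toEnd k L V e)) →
      ∃ n : ℕ, μ = -(n : k)) := by
  have hinv : ∀ w ∈ LinearMap.range (LieModule.toEnd k L V e),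
      ⁅h, w⁆ ∈ LinearMap.range (LieModule.toEnd k L V e) := by
    rintro _ ⟨v, rfl⟩
    refine ⟨⁅h, v⁆ + (2 : k) • v, ?_⟩
    simp only [LieModule.toEnd_apply_apply, lie_add, lie_smul, leibniz_lie h e v, he, smul_lie]
    exact add_comm _ _
  refine ⟨hinv, ?_⟩
  rintro μ ⟨v, hv, hhv⟩
  obtain ⟨φ, hφ, hφe, hφh⟩ := exists_dual_eigenvector_of_quotient_eigenvector
    (LieModule.toEnd k L V h) _ hinv hv hhv
  simp only [LieModule.toEnd_apply_apply] at hφh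
  by_cases h0 : h = 0
  · obtain ⟨w, hw⟩ := DFunLike.ne_iff.1 hφ
    have hμ := hφh w
    rw [h0, zero_lie, map_zero, eq_comm, mul_eq_zero] at hμ
    exact ⟨0, by simpa using hμ.resolve_right hw⟩
  · have t : IsSl2Triple h e f :=
      ⟨h0, hef, by rw [he, ofNat_smul_eq_nsmul], by rw [hf, neg_smul, ofNat_smul_eq_nsmul]⟩
    have P : t.HasPrimitiveVectorWith φ (-μ) :=
      { ne_zero := hφ
        lie_h := LinearMap.ext fun w ↦ by simp [hφh]
        lie_e := LinearMap.ext fun w ↦ by simp [hφe ⁅e, w⁆ ⟨w, rfl⟩] }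
    obtain ⟨n, hn⟩ := P.exists_nat
    exact ⟨n, by rw [← hn, neg_neg]⟩
end

section
/- Let k be a field of characteristic zero, g a finite-dimensional Lie algebra over k, and θ an involutive Lie algebra automorphism of g. Let x, h, f ∈ g form an sl2 triple with e := x (so [h,x] = 2x, [h,f] = −2f, [x,f] = h), and suppose θ(x) = −x and θ(h) = h. Then ad(h) preserves the subspace g^{−θ} and its subspace [x, g^θ] (the image of g^θ under ad(x)), and every eigenvalue of the endomorphism of the quotient g^{−θ} / [x, g^θ] induced by ad(h) is a non-positive integer. -/
/-- If an endomorphism `E` preserves a submodule `R` and sends some vector outside `R` into `R`,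
then some nonzero functional vanishes on both `R` and the range of `E`. -/
lemma exists_dual_ne_zero_of_not_injective_quotient {k V : Type*} [Field k] [AddCommGroup V]
    [Module k V] [Module.Finite k V] (E : V →ₗ[k] V) (R : Submodule k V)
    (hE : ∀ v ∈ R, E v ∈ R) {a : V} (ha : a ∉ R) (hEa : E a ∈ R) :
    ∃ φ : Module.Dual k V, φ ≠ 0 ∧ (∀ v ∈ R, φ v = 0) ∧ ∀ v, φ (E v) = 0 := by
  have hlt : R ⊔ LinearMap.range E < ⊤ := by
    refine lt_top_iff_ne_top.2 fun htop => ha ?_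
    have hsurj : Function.Surjective (R.mapQ R E hE) := by
      intro q
      obtain ⟨v, rfl⟩ := R.mkQ_surjective q
      obtain ⟨r, hr, _, ⟨w, rfl⟩, hw⟩ :=
        Submodule.mem_sup.1 (htop ▸ Submodule.mem_top : v ∈ R ⊔ LinearMap.range E)
      refine ⟨R.mkQ w, ?_⟩
      rw [← hw, map_add, R.mkQ_apply r, (Submodule.Quotient.mk_eq_zero R).2 hr, zero_add]
      rfl
    rw [← Submodule.Quotient.mk_eq_zero R]
    apply LinearMap.injective_iff_surjective.2 hsurj
    rw [map_zero, Submodule.mapQ_apply]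
    exact (Submodule.Quotient.mk_eq_zero R).2 hEa
  obtain ⟨φ, hφ, hle⟩ := Submodule.exists_le_ker_of_lt_top _ hlt
  exact ⟨φ, hφ, fun v hv => hle (Submodule.mem_sup_left hv),
    fun v => hle (Submodule.mem_sup_right ⟨v, rfl⟩)⟩

/-- For an `sl₂` triple acting on a finite-dimensional module `M`, the eigenvalues of `h` on
the cokernel of `e` are non-positive integers. -/
lemma IsSl2Triple.exists_nat_of_eigenvector_coker {k L M : Type*} [Field k] [CharZero k]
    [LieRing L] [LieAlgebra k L] [AddCommGroup M] [Module k M] [LieRingModule L M]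
    [LieModule k L M] [Module.Finite k M] {h e f : L} (t : IsSl2Triple h e f) {μ : k} {a : M}
    (ha : ∀ u : M, ⁅e, u⁆ ≠ a) (hμ : ∃ u : M, ⁅e, u⁆ = ⁅h, a⁆ - μ • a) :
    ∃ n : ℕ, μ = -(n : k) := by
  obtain ⟨φ, hφ, hφe, hφh⟩ := exists_dual_ne_zero_of_not_injective_quotient
    (LieModule.toEnd k L M h - μ • LinearMap.id) (LinearMap.range (LieModule.toEnd k L M e))
    (a := a) (by
      rintro _ ⟨u, rfl⟩
      refine ⟨⁅h, u⁆ + (2 - μ) • u, ?_⟩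
      simp only [LieModule.toEnd_apply_apply, LinearMap.sub_apply, LinearMap.smul_apply,
        LinearMap.id_apply, lie_add, lie_sub, lie_smul, leibniz_lie h e u, t.lie_h_e_smul k, smul_lie,
        sub_smul]
      abel)
    (by rintro ⟨u, hu⟩; exact ha u hu) hμ
  have P : t.HasPrimitiveVectorWith φ (-μ) :=
    { ne_zero := hφ
      lie_h := by
        ext v
        have hv := hφh v
        simp only [LinearMap.sub_apply, LieModule.toEnd_apply_apply, LinearMap.smul_apply,
          LinearMap.id_apply, map_sub, map_smul, sub_eq_zero] at hv
        simp [hv]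
      lie_e := by
        ext v
        simpa using hφe _ ⟨v, rfl⟩ }
  obtain ⟨n, hn⟩ := P.exists_nat
  exact ⟨n, by rw [← hn, neg_neg]⟩


/-- for an sl2 triple `(x, h, f)` with `θ x = -x`, `θ h = h`,
`ad h` preserves `S = g^{-θ}` and its subspace `T = [x, g^θ]`, and every eigenvalue
of the endomorphism induced by `ad h` on `S / T` is a non-positive integer. -/
theorem stmt_7 {k : Type*} [Field k] [CharZero k]
    {g : Type*} [LieRing g] [LieAlgebra k g] [Module.Finite k g]
    (θ : g →ₗ⁅k⁆ g) (hθ : ∀ a, θ (θ a) = a)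
    (x h f : g) (hhx : ⁅h, x⁆ = (2 : k) • x) (hhf : ⁅h, f⁆ = (-2 : k) • f)
    (hxf : ⁅x, f⁆ = h)
    (hθx : θ x = -x) (hθh : θ h = h)
    (S T : Submodule k g)
    (hS : ∀ a : g, a ∈ S ↔ θ a = -a)
    (hT : ∀ a : g, a ∈ T ↔ ∃ u : g, θ u = u ∧ ⁅x, u⁆ = a) :
    T ≤ S ∧ (∀ a ∈ S, ⁅h, a⁆ ∈ S) ∧ (∀ a ∈ T, ⁅h, a⁆ ∈ T) ∧
    (∀ μ : k, (∃ a ∈ S, a ∉ T ∧ ⁅h, a⁆ - μ • a ∈ T) → ∃ n : ℕ, μ = -(n : k)) := by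
  have hTS : T ≤ S := by
    intro a ha
    obtain ⟨u, hu, rfl⟩ := (hT a).1 ha
    rw [hS, LieHom.map_lie, hu, hθx, neg_lie]
  refine ⟨hTS, ?_, ?_, ?_⟩
  · intro a ha
    rw [hS] at ha ⊢
    rw [LieHom.map_lie, ha, hθh, lie_neg]
  · intro a ha
    obtain ⟨u, hu, rfl⟩ := (hT a).1 ha
    refine (hT _).2 ⟨⁅h, u⁆ + (2 : k) • u, ?_, ?_⟩
    · rw [map_add, map_smul, LieHom.map_lie, hu, hθh]
    · rw [leibniz_lie h x u, hhx, smul_lie, lie_add, lie_smul, add_comm]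
  · rintro μ ⟨a, haS, haT, hμ⟩
    obtain ⟨u, -, hu⟩ := (hT _).1 hμ
    by_cases h0 : h = 0
    · have hx : x = 0 := by simpa [h0] using hhx.symm
      have hμa : μ = 0 ∨ a = 0 := by simpa [h0, hx] using hu
      exact ⟨0, by simpa using hμa.resolve_right fun ha => haT (ha ▸ T.zero_mem)⟩
    · have t : IsSl2Triple h x f :=
        ⟨h0, hxf, by rw [hhx, ofNat_smul_eq_nsmul], by rw [hhf, neg_smul, ofNat_smul_eq_nsmul]⟩
      refine t.exists_nat_of_eigenvector_coker (a := a) ?_ ⟨u, hu⟩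
      rintro w rfl
      -- averaging a preimage over `θ` gives a fixed preimage
      refine haT ((hT _).2 ⟨(2⁻¹ : k) • (w + θ w), ?_, ?_⟩)
      · rw [map_smul, map_add, hθ, add_comm]
      · have hw := (hS _).1 haS
        rw [LieHom.map_lie, hθx, neg_lie, neg_inj] at hw
        rw [lie_smul, lie_add, hw, ← two_smul k, inv_smul_smul₀ two_ne_zero]
end

section
/- Let g be a nonzero finite-dimensional semisimple Lie algebra over a field k of characteristic zero, and let (e, h, f) be an sl2 triple in g. Let g_e := {a ∈ g | [e, a] = 0} be the centralizer of e; then ad(h) maps g_e into itself, and the trace of the restriction of ad(h) to g_e is an integer strictly smaller than dim g; i.e. there exists m ∈ ℤ with tr(ad(h)|_{g_e}) = (m : k) and m < dim_k g. -/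
open Module

namespace LinearMap

variable {k V : Type*} [Field k] [AddCommGroup V] [Module k V]

/-- If `T - c` maps `W` into `U ≤ W`, then the traces of `T` on `W` and on `U` differ by
`c * (dim W - dim U)`. -/
theorem trace_restrict_add_of_sub_smul_mem [FiniteDimensional k V] (T : End k V) (c : k)
    {U W : Submodule k V} (hUW : U ≤ W) (hU : ∀ v ∈ U, T v ∈ U) (hW : ∀ v ∈ W, T v ∈ W)
    (h : ∀ v ∈ W, T v - c • v ∈ U) :
    trace k W (T.restrict hW) + c * finrank k U =
      trace k U (T.restrict hU) + c * finrank k W := by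
  let B : W →ₗ[k] U := ((T - c • 1).comp W.subtype).codRestrict U fun w ↦ by
    simpa using h w w.2
  let A : U →ₗ[k] W := Submodule.inclusion hUW
  have hAB : A ∘ₗ B = T.restrict hW - c • LinearMap.id := by
    ext w
    simp [A, B]
  have hBA : B ∘ₗ A = T.restrict hU - c • LinearMap.id := by
    ext w
    simp [A, B]
  have key := trace_comp_comm' A B
  rw [hAB, hBA] at key
  simp only [map_sub, map_smul, trace_id, smul_eq_mul] at key
  linear_combination -key

/-- The subspace `ker E ∩ im E ^ n`, written as the image of `ker E ^ (n + 1)` under `E ^ n`. -/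
def kerInfRangePow (E : End k V) (n : ℕ) : Submodule k V :=
  (ker (E ^ (n + 1))).map (E ^ n)

theorem mem_kerInfRangePow {E : End k V} {n : ℕ} {v : V} :
    v ∈ kerInfRangePow E n ↔ ∃ w, (E ^ (n + 1)) w = 0 ∧ (E ^ n) w = v := by
  simp [kerInfRangePow]

theorem kerInfRangePow_succ_le (E : End k V) (n : ℕ) :
    kerInfRangePow E (n + 1) ≤ kerInfRangePow E n := by
  intro v hv
  obtain ⟨w, hw, rfl⟩ := mem_kerInfRangePow.1 hv
  refine mem_kerInfRangePow.2 ⟨E w, ?_, ?_⟩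
  · rwa [← Module.End.mul_apply, ← pow_succ]
  · rw [← Module.End.mul_apply, ← pow_succ]

theorem finrank_kerInfRangePow_add [FiniteDimensional k V] (E : End k V) (n : ℕ) :
    finrank k (kerInfRangePow E n) + finrank k (ker (E ^ n)) =
      finrank k (ker (E ^ (n + 1))) := by
  have hle : ker (E ^ n) ≤ ker (E ^ (n + 1)) := by
    rw [pow_succ']
    exact ker_le_ker_comp _ _
  rw [← finrank_range_add_finrank_ker ((E ^ n).domRestrict (ker (E ^ (n + 1)))),
    range_domRestrict, ker_domRestrict,
    (Submodule.comapSubtypeEquivOfLe hle).finrank_eq]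
  rfl

theorem kerInfRangePow_finrank_eq_bot [FiniteDimensional k V] (E : End k V) :
    kerInfRangePow E (finrank k V) = ⊥ := by
  rw [kerInfRangePow, Module.End.ker_pow_eq_ker_pow_finrank_of_le (Nat.le_succ _),
    Submodule.eq_bot_iff]
  rintro _ ⟨w, hw, rfl⟩
  exact hw

section Sl2

variable {E F H : End k V}

theorem pow_succ_mul_of_sl2_relations (hHE : H * E - E * H = (2 : k) • E)
    (hEF : E * F - F * E = H) (n : ℕ) :
    E ^ (n + 1) * F = F * E ^ (n + 1) + ((n : k) + 1) • (H * E ^ n - (n : k) • E ^ n) := by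
  have hEH : E * H = H * E - (2 : k) • E := by rw [← hHE]; abel
  have hEF' : E * F = F * E + H := by rw [← hEF]; abel
  induction n with
  | zero => simp [hEF']
  | succ n ih =>
    rw [pow_succ' E (n + 1), mul_assoc, ih, mul_add, ← mul_assoc, hEF', mul_smul_comm, mul_sub,
      ← mul_assoc E H, hEH, mul_smul_comm, ← pow_succ' E n, sub_mul, smul_mul_assoc,
      mul_assoc H E, ← pow_succ' E n, add_mul, mul_assoc F E]
    push_cast
    module

theorem sub_smul_mem_kerInfRangePow_succ [CharZero k] (hHE : H * E - E * H = (2 : k) • E)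
    (hEF : E * F - F * E = H) (n : ℕ) {v : V} (hv : v ∈ kerInfRangePow E n) :
    H v - (n : k) • v ∈ kerInfRangePow E (n + 1) := by
  obtain ⟨w, hw, rfl⟩ := mem_kerInfRangePow.1 hv
  have hn : (n : k) + 1 ≠ 0 := Nat.cast_add_one_ne_zero n
  have h₁ := LinearMap.congr_fun (pow_succ_mul_of_sl2_relations hHE hEF n) w
  simp only [Module.End.mul_apply, add_apply, sub_apply, smul_apply, hw, map_zero,
    zero_add] at h₁
  have h₂ := LinearMap.congr_fun hHE ((E ^ n) w)
  have hw' : E ((E ^ n) w) = 0 := by rwa [← Module.End.mul_apply, ← pow_succ']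
  simp only [Module.End.mul_apply, sub_apply, smul_apply, hw', map_zero, smul_zero,
    zero_sub, neg_eq_zero] at h₂
  refine mem_kerInfRangePow.2 ⟨((n : k) + 1)⁻¹ • F w, ?_, ?_⟩
  · rw [pow_succ', Module.End.mul_apply, map_smul, h₁, inv_smul_smul₀ hn]
    simp [h₂, hw']
  · rw [map_smul, h₁, inv_smul_smul₀ hn]

theorem map_mem_kerInfRangePow [CharZero k] (hHE : H * E - E * H = (2 : k) • E)
    (hEF : E * F - F * E = H) (n : ℕ) : ∀ v ∈ kerInfRangePow E n, H v ∈ kerInfRangePow E n := by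
  intro v hv
  have := add_mem
    (kerInfRangePow_succ_le E n (sub_smul_mem_kerInfRangePow_succ hHE hEF n hv))
    (Submodule.smul_mem _ (n : k) hv)
  rwa [sub_add_cancel] at this

theorem trace_restrict_kerInfRangePow_zero_add [FiniteDimensional k V] [CharZero k]
    (hHE : H * E - E * H = (2 : k) • E) (hEF : E * F - F * E = H) (n : ℕ) :
    trace k _ (H.restrict (map_mem_kerInfRangePow hHE hEF 0)) +
        n * finrank k (kerInfRangePow E n) + finrank k (ker E) =
      trace k _ (H.restrict (map_mem_kerInfRangePow hHE hEF n)) +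
        finrank k (ker (E ^ (n + 1))) := by
  induction n with
  | zero => rw [zero_add, pow_one]; simp
  | succ n ih =>
    have h₁ := trace_restrict_add_of_sub_smul_mem H (n : k) (kerInfRangePow_succ_le E n)
      (map_mem_kerInfRangePow hHE hEF (n + 1)) (map_mem_kerInfRangePow hHE hEF n)
      fun v hv ↦ sub_smul_mem_kerInfRangePow_succ hHE hEF n hv
    have h₂ := congrArg (Nat.cast (R := k)) (finrank_kerInfRangePow_add E (n + 1))
    push_cast at h₂ ⊢
    linear_combination ih + h₁ + h₂

/-- The trace of `H` on `ker E` is the dimension of the generalized kernel of `E` minus the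
dimension of `ker E`. -/
theorem trace_restrict_ker_of_sl2_relations [FiniteDimensional k V] [CharZero k]
    (hHE : H * E - E * H = (2 : k) • E) (hEF : E * F - F * E = H)
    (hH : ∀ v ∈ ker E, H v ∈ ker E) :
    trace k _ (H.restrict hH) + finrank k (ker E) =
      finrank k (ker (E ^ finrank k V)) := by
  have h₀ : kerInfRangePow E 0 = ker E := by
    ext v
    simp [mem_kerInfRangePow]
  have key := trace_restrict_kerInfRangePow_zero_add hHE hEF (finrank k V)
  have hbot := kerInfRangePow_finrank_eq_bot E
  have : Subsingleton (kerInfRangePow E (finrank k V)) := by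
    rw [hbot]
    infer_instance
  have hzero : H.restrict (map_mem_kerInfRangePow hHE hEF (finrank k V)) = 0 :=
    Subsingleton.elim _ _
  rw [hzero, map_zero, hbot, finrank_bot, Nat.cast_zero, mul_zero, add_zero, zero_add,
    Module.End.ker_pow_eq_ker_pow_finrank_of_le (Nat.le_succ _)] at key
  rw [← h₀] at key
  revert hH
  rw [← h₀]
  exact fun _ ↦ key

end Sl2

end LinearMap

/-- for an sl2 triple `(e, h, f)` in a nonzero finite-dimensional
semisimple Lie algebra over a field of characteristic zero, `ad h` preserves the
centralizer `g_e` of `e`, and the trace of its restriction to `g_e` is an integer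
strictly smaller than `dim g`. -/
theorem stmt_9 {k : Type*} [Field k] [CharZero k]
    {g : Type*} [LieRing g] [LieAlgebra k g] [Module.Finite k g] [Nontrivial g]
    [LieAlgebra.IsSemisimple k g]
    (e h f : g) (he : ⁅h, e⁆ = (2 : k) • e) (hf : ⁅h, f⁆ = (-2 : k) • f)
    (hef : ⁅e, f⁆ = h)
    (C : Submodule k g) (hC : ∀ a : g, a ∈ C ↔ ⁅e, a⁆ = 0) :
    ∃ hmap : ∀ a ∈ C, (LieAlgebra.ad k g h) a ∈ C,
      ∃ m : ℤ,
        LinearMap.trace k C (LinearMap.restrict (LieAlgebra.ad k g h) hmap) = (m : k) ∧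
        m < Module.finrank k g := by
  have hHE : LieAlgebra.ad k g h * LieAlgebra.ad k g e - LieAlgebra.ad k g e * LieAlgebra.ad k g h =
      (2 : k) • LieAlgebra.ad k g e := by
    ext a
    simpa [he, eq_comm] using lie_lie h e a
  have hEF : LieAlgebra.ad k g e * LieAlgebra.ad k g f - LieAlgebra.ad k g f * LieAlgebra.ad k g e =
      LieAlgebra.ad k g h := by
    ext a
    simpa [hef, eq_comm] using lie_lie e f a
  obtain rfl : C = LinearMap.ker (LieAlgebra.ad k g e) := by
    ext a
    simp [hC]
  have hmap : ∀ a ∈ LinearMap.ker (LieAlgebra.ad k g e),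
      (LieAlgebra.ad k g h) a ∈ LinearMap.ker (LieAlgebra.ad k g e) := by
    intro a ha
    have hea : ⁅e, a⁆ = 0 := by simpa using ha
    have h_lie := lie_lie h e a
    rw [he, smul_lie, hea, lie_zero, smul_zero, zero_sub, eq_comm, neg_eq_zero] at h_lie
    simpa using h_lie
  have htr := LinearMap.trace_restrict_ker_of_sl2_relations hHE hEF hmap
  have hpos : 0 < finrank k (LinearMap.ker (LieAlgebra.ad k g e)) := by
    rw [finrank_pos_iff, Submodule.nontrivial_iff_ne_bot, Submodule.ne_bot_iff]
    rcases eq_or_ne e 0 with rfl | h_ne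
    · obtain ⟨a, ha⟩ := exists_ne (0 : g)
      exact ⟨a, by simp, ha⟩
    · exact ⟨e, by simp, h_ne⟩
  have hle := (LinearMap.ker (LieAlgebra.ad k g e ^ finrank k g)).finrank_le
  refine ⟨hmap, finrank k (LinearMap.ker (LieAlgebra.ad k g e ^ finrank k g)) -
    finrank k (LinearMap.ker (LieAlgebra.ad k g e)), ?_, by lia⟩
  push_cast
  linear_combination htr
end

section
/- Let k be a field of characteristic zero, L a Lie algebra over k containing an sl2 triple (e, h, f), and V an L-module (not necessarily finite-dimensional) with action ρ. Let v ∈ V and suppose there exist natural numbers m, n such that ρ(e)^m v = 0 and ρ(f)^n v = 0. Then there exists a finite-dimensional subspace W ⊆ V containing v that is invariant under ρ(e), ρ(h), and ρ(f); in particular, the submodule of V over the span of e, h, f generated by v is finite-dimensional. -/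
section Sl2Relations

variable {k A : Type*} [Field k] [Ring A] [Algebra k A] {e h f : A}

/-- An `sl₂`-relation: powers of `e` shift `h` by an even integer. -/
lemma semiconjBy_pow_of_commutator (he : h * e - e * h = 2 * e) (j : ℕ) :
    SemiconjBy (e ^ j) h (h - 2 * (j : A)) := by
  have h1 : e * h = h * e - 2 * e := by rw [← he]; abel
  induction j with
  | zero => simp [SemiconjBy]
  | succ j ih =>
    have ih' : e ^ j * h = (h - 2 * (j : A)) * e ^ j := ih
    have hj : e * (j : A) = j * e := (Nat.cast_commute j e).symm.eq
    change e ^ (j + 1) * h = _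
    rw [pow_succ', mul_assoc, ih', ← mul_assoc, ← mul_assoc]
    congr 1
    rw [mul_sub, h1, two_mul (j : A), mul_add, hj]
    push_cast
    noncomm_ring

/-- In `sl₂`, moving `f` across a power of `e`. -/
lemma mul_pow_succ_of_commutator (he : h * e - e * h = 2 * e) (hef : e * f - f * e = h) (c : ℕ) :
    f * e ^ (c + 1) = e ^ (c + 1) * f - ((c : A) + 1) * (e ^ c * (h + c)) := by
  have h1 : h * e = e * h + 2 * e := by rw [← he]; abel
  have h2 : f * e = e * f - h := by rw [← hef]; abel
  induction c with
  | zero => simp [h2]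
  | succ c ih =>
    have hc : (c : A) * e = e * c := (Nat.cast_commute c e).eq
    have key : e ^ c * (h + c) * e = e ^ (c + 1) * (h + c + 2) := by
      rw [mul_assoc, add_mul, h1, hc, pow_succ, mul_assoc]
      congr 1
      noncomm_ring
    rw [pow_succ e (c + 1), ← mul_assoc, ih, sub_mul, mul_assoc _ f e, h2, mul_assoc _ _ e, key]
    have hc' : (c : A) * e ^ (c + 1) = e ^ (c + 1) * c := (Nat.cast_commute c _).eq
    push_cast
    generalize e ^ (c + 1) = x at *
    have hcx (y : A) : (c : A) * (x * y) = x * (c * y) := by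
      rw [← mul_assoc, hc', mul_assoc]
    simp only [add_mul, mul_add, mul_sub, one_mul, hcx, mul_assoc]
    have h22 : (c : A) * 2 = c + c := mul_two _
    simp only [h22, mul_two, mul_add, mul_one]
    abel

lemma SemiconjBy.aeval_right {x a b : A} (hx : SemiconjBy x a b) (p : Polynomial k) :
    SemiconjBy x (Polynomial.aeval a p) (Polynomial.aeval b p) := by
  induction p using Polynomial.induction_on' with
  | add p q hp hq => simpa using hp.add_right hq
  | monomial n c =>
    simp only [Polynomial.aeval_monomial]
    exact SemiconjBy.mul_right (Algebra.commutes c x).symm (hx.pow_right n)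

end Sl2Relations

section Sl2Operators

open Module Polynomial

variable {k V : Type*} [Field k] [AddCommGroup V] [Module k V] {e h f : End k V}

lemma SemiconjBy.aeval_apply_eq_zero {x a b : End k V} (hx : SemiconjBy x a b) {v : V}
    (hv : x v = 0) (p : k[X]) : x (aeval a p v) = 0 := by
  have := LinearMap.congr_fun (hx.aeval_right p).eq v
  simpa [hv] using this

/-- The span of all `x ^ c T`, for `c : ℕ`. -/
def Submodule.iSupMapPow (x : End k V) (T : Submodule k V) : Submodule k V :=
  ⨆ c : ℕ, T.map (x ^ c)

namespace Submodule

variable {x : End k V} {T : Submodule k V}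

lemma pow_apply_mem_iSupMapPow (c : ℕ) {t : V} (ht : t ∈ T) : (x ^ c) t ∈ T.iSupMapPow x :=
  le_iSup (fun c : ℕ => T.map (x ^ c)) c (mem_map_of_mem ht)

lemma le_iSupMapPow : T ≤ T.iSupMapPow x := fun t ht => by
  simpa using pow_apply_mem_iSupMapPow (x := x) 0 ht

lemma iSupMapPow_le {P : Submodule k V} (hP : ∀ (c : ℕ), ∀ t ∈ T, (x ^ c) t ∈ P) :
    T.iSupMapPow x ≤ P :=
  iSup_le fun c => map_le_iff_le_comap.2 fun t ht => hP c t ht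

lemma apply_mem_iSupMapPow {w : V} (hw : w ∈ T.iSupMapPow x) : x w ∈ T.iSupMapPow x := by
  refine iSupMapPow_le (P := (T.iSupMapPow x).comap x) (fun c t ht => ?_) hw
  rw [mem_comap, ← Module.End.mul_apply, ← pow_succ']
  exact pow_apply_mem_iSupMapPow _ ht

lemma finite_iSupMapPow [Module.Finite k T] (M : ℕ) (hM : ∀ t ∈ T, (x ^ M) t = 0) :
    Module.Finite k (T.iSupMapPow x) := by
  have hle : T.iSupMapPow x ≤ ⨆ c : Fin M, T.map (x ^ (c : ℕ)) := by
    refine iSupMapPow_le fun c t ht => ?_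
    rcases lt_or_ge c M with hc | hc
    · exact le_iSup (fun c : Fin M => T.map (x ^ (c : ℕ))) ⟨c, hc⟩ (mem_map_of_mem ht)
    · rw [Module.End.pow_map_zero_of_le hc (hM t ht)]
      exact zero_mem _
  exact finiteDimensional_of_le hle

/-- If `T` is stable under `h` and `[h, e] = 2e`, so is the span of all `e ^ c T`. -/
lemma h_mem_iSupMapPow (he : h * e - e * h = 2 * e) (hT : ∀ t ∈ T, h t ∈ T)
    {w : V} (hw : w ∈ T.iSupMapPow e) : h w ∈ T.iSupMapPow e := by
  refine iSupMapPow_le (P := (T.iSupMapPow e).comap h) (fun c t ht => ?_) hw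
  have key := LinearMap.congr_fun (semiconjBy_pow_of_commutator he c).eq t
  have h1 : h ((e ^ c) t) = (e ^ c) (h t) + (2 * c) • (e ^ c) t := by
    rw [Module.End.mul_apply] at key
    rw [key]
    simp [sub_mul, mul_smul]
  rw [mem_comap, h1]
  exact add_mem (pow_apply_mem_iSupMapPow _ (hT t ht))
    (smul_of_tower_mem _ _ (pow_apply_mem_iSupMapPow _ ht))

/-- If `T` is stable under `h` and `f`, then the span of all `e ^ c T` is stable under `f`. -/
lemma f_mem_iSupMapPow (he : h * e - e * h = 2 * e) (hef : e * f - f * e = h)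
    (hT : ∀ t ∈ T, h t ∈ T) (hTf : ∀ t ∈ T, f t ∈ T)
    {w : V} (hw : w ∈ T.iSupMapPow e) : f w ∈ T.iSupMapPow e := by
  refine iSupMapPow_le (P := (T.iSupMapPow e).comap f) (fun c t ht => ?_) hw
  rw [mem_comap]
  rcases c with _ | c
  · exact le_iSupMapPow (hTf t ht)
  have key := LinearMap.congr_fun (mul_pow_succ_of_commutator he hef c) t
  rw [Module.End.mul_apply] at key
  rw [key]
  have h1 : (h + (c : End k V)) t ∈ T := by
    simpa using T.add_mem (hT t ht) (T.smul_of_tower_mem c ht)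
  have h2 := pow_apply_mem_iSupMapPow (x := e) c h1
  refine sub_mem (pow_apply_mem_iSupMapPow (c + 1) (hTf t ht)) ?_
  simpa [add_mul] using add_mem ((T.iSupMapPow e).smul_of_tower_mem c h2) h2

end Submodule

/-- A vector killed by `e` and by a power of `f` is annihilated by a nonzero polynomial in `h`. -/
lemma exists_aeval_eq_zero_of_apply_eq_zero [CharZero k] (he : h * e - e * h = 2 * e)
    (hf : h * f - f * h = -(2 * f)) (hef : e * f - f * e = h) (n : ℕ) {w : V}
    (hew : e w = 0) (hfw : (f ^ n) w = 0) : ∃ p : k[X], p ≠ 0 ∧ aeval h p w = 0 := by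
  induction n generalizing w with
  | zero => exact ⟨1, one_ne_zero, by simpa using hfw⟩
  | succ n ih =>
    have hf' : (-h) * f - f * (-h) = 2 * f := by
      rw [← neg_neg (2 * f), ← hf]; noncomm_ring
    have hfe : f * e - e * f = -h := by rw [← hef]; abel
    have key := LinearMap.congr_fun (mul_pow_succ_of_commutator hf' hfe n) w
    have hs := semiconjBy_pow_of_commutator he 1
    rw [pow_one] at hs
    have hq : aeval h (X - C (n : k)) w = -((-h + (n : End k V)) w) := by
      simp [sub_eq_add_neg, add_comm]
    have hfn : (f ^ n) (aeval h (X - C (n : k)) w) = 0 := by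
      rw [Module.End.mul_apply, hfw, map_zero, LinearMap.sub_apply, Module.End.mul_apply, hew,
        map_zero, zero_sub, eq_comm, neg_eq_zero] at key
      have key' : ((n : k) + 1) • (f ^ n) ((-h + (n : End k V)) w) = 0 := by
        rw [← key]
        simp [add_mul, add_smul, Nat.cast_smul_eq_nsmul]
        abel
      rw [hq, map_neg, (smul_eq_zero.1 key').resolve_left (Nat.cast_add_one_ne_zero n), neg_zero]
    obtain ⟨p, hp, hpw⟩ := ih (hs.aeval_apply_eq_zero hew _) hfn
    exact ⟨p * (X - C (n : k)), mul_ne_zero hp (X_sub_C_ne_zero _), by simpa using hpw⟩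

/-- If `e ^ m` kills `t`, then `e ^ (m + 1)` kills `f t`. -/
lemma pow_succ_apply_eq_zero (he : h * e - e * h = 2 * e) (hef : e * f - f * e = h) {m : ℕ}
    {t : V} (ht : (e ^ m) t = 0) : (e ^ (m + 1)) (f t) = 0 := by
  have key := LinearMap.congr_fun (mul_pow_succ_of_commutator he hef m) t
  have hs := LinearMap.congr_fun (semiconjBy_pow_of_commutator he m).eq t
  have ht' : (e ^ m) (h t) = 0 := by simpa [ht] using hs
  rw [LinearMap.sub_apply, Module.End.mul_apply, pow_succ', Module.End.mul_apply, ht, map_zero,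
    map_zero] at key
  rw [pow_succ']
  simpa [ht, ht', add_mul, eq_comm] using key

lemma pow_add_apply_pow_eq_zero (he : h * e - e * h = 2 * e) (hef : e * f - f * e = h) {m : ℕ}
    {t : V} (ht : (e ^ m) t = 0) (a : ℕ) : (e ^ (m + a)) ((f ^ a) t) = 0 := by
  induction a with
  | zero => simpa using ht
  | succ a ih =>
    rw [pow_succ' f, Module.End.mul_apply, ← add_assoc]
    exact pow_succ_apply_eq_zero he hef ih

/-- A vector killed by powers of `e` and `f` is annihilated by a nonzero polynomial in `h`. -/
lemma exists_aeval_eq_zero_of_pow_apply_eq_zero [CharZero k] (he : h * e - e * h = 2 * e)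
    (hf : h * f - f * h = -(2 * f)) (hef : e * f - f * e = h) (m n : ℕ) {v : V}
    (hev : (e ^ m) v = 0) (hfv : (f ^ n) v = 0) : ∃ p : k[X], p ≠ 0 ∧ aeval h p v = 0 := by
  have hf' : (-h) * f - f * (-h) = 2 * f := by
    rw [← neg_neg (2 * f), ← hf]; noncomm_ring
  have hfe : f * e - e * f = -h := by rw [← hef]; abel
  induction m generalizing v with
  | zero => exact ⟨1, one_ne_zero, by simpa using hev⟩
  | succ m ih =>
    obtain ⟨p, hp, hpw⟩ := exists_aeval_eq_zero_of_apply_eq_zero he hf hef (n + m)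
      (w := (e ^ m) v) (by rwa [← Module.End.mul_apply, ← pow_succ'])
      (pow_add_apply_pow_eq_zero hf' hfe hfv m)
    have hs : SemiconjBy (e ^ m) (h + 2 * (m : End k V)) h := by
      have h1 := (semiconjBy_pow_of_commutator he m).add_right
        ((Nat.cast_commute (2 * m) (e ^ m)).symm)
      simpa using h1
    have hcomp : aeval h (p.comp (X + C (2 * (m : k)))) = aeval (h + 2 * (m : End k V)) p := by
      simp [aeval_comp, map_ofNat (algebraMap k (End k V))]
    have hq : (e ^ m) (aeval h (p.comp (X + C (2 * (m : k)))) v) = 0 := by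
      rw [hcomp]
      exact (LinearMap.congr_fun (hs.aeval_right p).eq v).trans hpw
    have hsf : SemiconjBy (f ^ n) h (-(-h - 2 * (n : End k V))) := by
      simpa using (semiconjBy_pow_of_commutator hf' n).neg_right
    obtain ⟨q, hq0, hqv⟩ := ih hq (hsf.aeval_apply_eq_zero hfv _)
    refine ⟨q * p.comp (X + C (2 * (m : k))), mul_ne_zero hq0 ?_, by simpa using hqv⟩
    rwa [Ne, comp_X_add_C_eq_zero_iff]

/-- A vector annihilated by a nonzero polynomial in `h` has finite-dimensional cyclic span. -/
lemma finite_range_aeval_apply {v : V} {p : k[X]} (hp : p ≠ 0) (hpv : aeval h p v = 0) :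
    Module.Finite k ((LinearMap.applyₗ v).comp (aeval (R := k) h).toLinearMap).range := by
  have hle : ((LinearMap.applyₗ v).comp (aeval (R := k) h).toLinearMap).range ≤
      (degreeLT k p.natDegree).map ((LinearMap.applyₗ v).comp (aeval (R := k) h).toLinearMap) := by
    rintro _ ⟨q, rfl⟩
    refine ⟨q % p, ?_, ?_⟩
    · rw [SetLike.mem_coe, mem_degreeLT, ← degree_eq_natDegree hp]
      exact EuclideanDomain.mod_lt q hp
    · have hq : q = q / p * p + q % p := by rw [mul_comm, EuclideanDomain.div_add_mod]
      conv_rhs => rw [hq]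
      simp [hpv]
  have : Module.Finite k (degreeLT k p.natDegree) :=
    Module.Finite.equiv (degreeLTEquiv k p.natDegree).symm
  exact Submodule.finiteDimensional_of_le hle

/-- If an `sl₂`-triple of operators has `e` and `f` nilpotent on `v`, then `v` lies in a
finite-dimensional invariant subspace. -/
theorem exists_finite_invariant_submodule [CharZero k] (he : h * e - e * h = 2 * e)
    (hf : h * f - f * h = -(2 * f)) (hef : e * f - f * e = h) (m n : ℕ) {v : V}
    (hev : (e ^ m) v = 0) (hfv : (f ^ n) v = 0) :
    ∃ W : Submodule k V, v ∈ W ∧ Module.Finite k W ∧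
      (∀ w ∈ W, e w ∈ W) ∧ (∀ w ∈ W, h w ∈ W) ∧ (∀ w ∈ W, f w ∈ W) := by
  have hf' : (-h) * f - f * (-h) = 2 * f := by
    rw [← neg_neg (2 * f), ← hf]; noncomm_ring
  obtain ⟨p, hp, hpv⟩ := exists_aeval_eq_zero_of_pow_apply_eq_zero he hf hef m n hev hfv
  have hfin := finite_range_aeval_apply hp hpv
  set T := ((LinearMap.applyₗ v).comp (aeval (R := k) h).toLinearMap).range
  have hvT : v ∈ T := ⟨1, by simp⟩
  have hhT : ∀ t ∈ T, h t ∈ T := by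
    rintro _ ⟨q, rfl⟩
    exact ⟨X * q, by simp⟩
  have heT : ∀ t ∈ T, (e ^ m) t = 0 := by
    rintro _ ⟨q, rfl⟩
    exact (semiconjBy_pow_of_commutator he m).aeval_apply_eq_zero hev q
  have hfT : ∀ t ∈ T, (f ^ n) t = 0 := by
    rintro _ ⟨q, rfl⟩
    have hsf : SemiconjBy (f ^ n) h (-(-h - 2 * (n : End k V))) := by
      simpa using (semiconjBy_pow_of_commutator hf' n).neg_right
    exact hsf.aeval_apply_eq_zero hfv q
  have hfin' := T.finite_iSupMapPow n hfT
  have hhU : ∀ t ∈ T.iSupMapPow f, h t ∈ T.iSupMapPow f := fun t ht => by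
    have := Submodule.h_mem_iSupMapPow hf' (fun t ht => T.neg_mem (hhT t ht)) ht
    simpa using this
  have heU : ∀ t ∈ T.iSupMapPow f, (e ^ (m + n)) t = 0 := by
    refine fun t ht => Submodule.iSupMapPow_le (P := (e ^ (m + n)).ker) (fun c t ht => ?_) ht
    rw [LinearMap.mem_ker]
    rcases le_total n c with hc | hc
    · rw [Module.End.pow_map_zero_of_le hc (hfT t ht), map_zero]
    · exact Module.End.pow_map_zero_of_le (by lia)
        (pow_add_apply_pow_eq_zero he hef (heT t ht) c)
  exact ⟨(T.iSupMapPow f).iSupMapPow e,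
    Submodule.le_iSupMapPow (Submodule.le_iSupMapPow hvT),
    Submodule.finite_iSupMapPow _ heU,
    fun _ => Submodule.apply_mem_iSupMapPow,
    fun _ => Submodule.h_mem_iSupMapPow he hhU,
    fun _ => Submodule.f_mem_iSupMapPow he hef hhU fun _ => Submodule.apply_mem_iSupMapPow⟩

end Sl2Operators


/-- if `ρ(e)^m v = 0` and `ρ(f)^n v = 0` for an sl2 triple `(e, h, f)`,
then `v` lies in a finite-dimensional subspace invariant under `ρ(e)`, `ρ(h)`, `ρ(f)`. -/
theorem stmt_10 {k : Type*} [Field k] [CharZero k]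
    {L : Type*} [LieRing L] [LieAlgebra k L]
    (e h f : L) (he : ⁅h, e⁆ = (2 : k) • e) (hf : ⁅h, f⁆ = (-2 : k) • f)
    (hef : ⁅e, f⁆ = h)
    {V : Type*} [AddCommGroup V] [Module k V] [LieRingModule L V] [LieModule k L V]
    (v : V) (m n : ℕ)
    (hve : (LieModule.toEnd k L V e ^ m) v = 0)
    (hvf : (LieModule.toEnd k L V f ^ n) v = 0) :
    ∃ W : Submodule k V, v ∈ W ∧ Module.Finite k W ∧
      (∀ w ∈ W, ⁅e, w⁆ ∈ W) ∧ (∀ w ∈ W, ⁅h, w⁆ ∈ W) ∧ (∀ w ∈ W, ⁅f, w⁆ ∈ W) := by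
  refine exists_finite_invariant_submodule (e := LieModule.toEnd k L V e)
    (h := LieModule.toEnd k L V h) (f := LieModule.toEnd k L V f) ?_ ?_ ?_ m n hve hvf
  · ext w
    simpa [he, ofNat_smul_eq_nsmul] using (lie_lie h e w).symm
  · ext w
    simpa [hf, ofNat_smul_eq_nsmul] using (lie_lie h f w).symm
  · ext w
    simpa [hef] using (lie_lie e f w).symm
end

section
/- Let k be a field, L a Lie algebra over k containing an sl2 triple (e, h, f), and V an L-module with action ρ. Let v ∈ V satisfy ρ(e) v = 0. Then for every natural number l, ρ(e)^l (ρ(f)^l v) = l! · (∏_{i=0}^{l−1} (ρ(h) − i·id)) v, where the product is the composition of the commuting endomorphisms ρ(h) − i·id for i = 0, …, l−1. -/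
section Sl2

open LieModule

variable {R L V : Type*} [CommRing R] [LieRing L] [LieAlgebra R L]
  [AddCommGroup V] [Module R V] [LieRingModule L V] [LieModule R L V] {e h f : L}

/-- Powers of `f` lower the weight by two at each step. -/
lemma lie_h_toEnd_f_pow_apply (hf : ⁅h, f⁆ = (-2 : R) • f) (v : V) (n : ℕ) :
    ⁅h, (toEnd R L V f ^ n) v⁆ =
      (toEnd R L V f ^ n) ⁅h, v⁆ - (2 * n : R) • (toEnd R L V f ^ n) v := by
  induction n with
  | zero => simp
  | succ n ih =>
    simp only [pow_succ', Module.End.mul_apply, toEnd_apply_apply]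
    rw [leibniz_lie, hf, smul_lie, ih, lie_sub, lie_smul]
    push_cast
    module

/-- The action of `e` on `f ^ (n + 1)` applied to a vector killed by `e`. -/
lemma lie_e_toEnd_f_pow_succ_apply (hf : ⁅h, f⁆ = (-2 : R) • f) (hef : ⁅e, f⁆ = h)
    {v : V} (hv : ⁅e, v⁆ = 0) (n : ℕ) :
    ⁅e, (toEnd R L V f ^ (n + 1)) v⁆ =
      (n + 1 : R) • (toEnd R L V f ^ n) (⁅h, v⁆ - (n : R) • v) := by
  induction n with
  | zero => simp [leibniz_lie e f v, hef, hv]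
  | succ n ih =>
    rw [pow_succ', Module.End.mul_apply, toEnd_apply_apply, leibniz_lie, hef, ih,
      lie_h_toEnd_f_pow_apply hf, lie_smul, ← toEnd_apply_apply R L V f,
      ← Module.End.mul_apply, ← pow_succ', map_sub, map_sub, map_smul, map_smul]
    push_cast
    module

/-- The kernel of `e` is stable under `h - c`. -/
lemma lie_e_lie_h_sub_smul_eq_zero (he : ⁅h, e⁆ = (2 : R) • e) {v : V} (hv : ⁅e, v⁆ = 0)
    (c : R) : ⁅e, ⁅h, v⁆ - c • v⁆ = 0 := by
  rw [lie_sub, lie_smul, leibniz_lie, ← lie_skew, he, neg_lie, smul_lie, hv]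
  simp

end Sl2

/-- if `ρ(e) v = 0` for an sl2 triple `(e, h, f)`, then for every `l`,
`ρ(e)^l ρ(f)^l v = l! ⬝ (∏_{i=0}^{l-1} (ρ(h) - i)) v`. -/
theorem stmt_11 {k : Type*} [Field k]
    {L : Type*} [LieRing L] [LieAlgebra k L]
    (e h f : L) (he : ⁅h, e⁆ = (2 : k) • e) (hf : ⁅h, f⁆ = (-2 : k) • f)
    (hef : ⁅e, f⁆ = h)
    {V : Type*} [AddCommGroup V] [Module k V] [LieRingModule L V] [LieModule k L V]
    (v : V) (hv : ⁅e, v⁆ = 0) (l : ℕ) :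
    (LieModule.toEnd k L V e ^ l) ((LieModule.toEnd k L V f ^ l) v) =
      l.factorial •
        (((List.range l).map
            (fun i : ℕ => LieModule.toEnd k L V h - (i : k) • (1 : Module.End k V))).prod v) := by
  induction l generalizing v with
  | zero => simp
  | succ l ih =>
    rw [pow_succ, Module.End.mul_apply, LieModule.toEnd_apply_apply,
      lie_e_toEnd_f_pow_succ_apply hf hef hv, map_smul,
      ih _ (lie_e_lie_h_sub_smul_eq_zero he hv _), List.range_succ, List.map_append,
      List.prod_append, Module.End.mul_apply, Nat.factorial_succ, mul_smul,
      ← Nat.cast_smul_eq_nsmul k (l + 1)]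
    simp
end

section
/- Let k be a field of characteristic zero, L a Lie algebra over k containing an sl2 triple (e, h, f), and V an L-module with action ρ. Let v ∈ V satisfy ρ(e) v = 0 and ρ(f)^n v = 0 for some natural number n. Then (∏_{i=0}^{n−1} (ρ(h) − i·id)) v = 0. -/
/-- The commutation formula `e f ^ (n + 1) = f ^ (n + 1) e + (n + 1) f ^ n (h - n)` for elements of
an associative algebra satisfying `e f = f e + h` and `h f = f h - 2 f`. -/
lemma sl2_mul_pow_succ {k A : Type*} [CommRing k] [Ring A] [Algebra k A] {e h f : A}
    (hef : e * f = f * e + h) (hhf : h * f = f * h - (2 : k) • f) (n : ℕ) :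
    e * f ^ (n + 1) = f ^ (n + 1) * e + ((n : k) + 1) • (f ^ n * (h - (n : k) • (1 : A))) := by
  induction n with
  | zero => simp [hef]
  | succ n ih =>
    have key : f ^ n * (h - (n : k) • (1 : A)) * f =
        f ^ (n + 1) * h - ((n : k) + 2) • f ^ (n + 1) := by
      rw [mul_assoc, sub_mul, hhf, smul_mul_assoc, one_mul, mul_sub, mul_sub, mul_smul_comm,
        mul_smul_comm, ← mul_assoc, ← pow_succ]
      module
    rw [pow_succ f (n + 1), ← mul_assoc, ih, add_mul, mul_assoc _ e f, hef, smul_mul_assoc, key,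
      mul_add, ← mul_assoc, mul_sub, mul_smul_comm, mul_one]
    push_cast
    module

/-- if `ρ(e) v = 0` and `ρ(f)^n v = 0` for an sl2 triple `(e, h, f)`
over a field of characteristic zero, then `(∏_{i=0}^{n-1} (ρ(h) - i)) v = 0`. -/
theorem stmt_12 {k : Type*} [Field k] [CharZero k]
    {L : Type*} [LieRing L] [LieAlgebra k L]
    (e h f : L) (he : ⁅h, e⁆ = (2 : k) • e) (hf : ⁅h, f⁆ = (-2 : k) • f)
    (hef : ⁅e, f⁆ = h)
    {V : Type*} [AddCommGroup V] [Module k V] [LieRingModule L V] [LieModule k L V]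
    (v : V) (hv : ⁅e, v⁆ = 0) (n : ℕ)
    (hvf : (LieModule.toEnd k L V f ^ n) v = 0) :
    (((List.range n).map
        (fun i : ℕ => LieModule.toEnd k L V h - (i : k) • (1 : Module.End k V))).prod) v = 0 := by
  have hEF : LieModule.toEnd k L V e * LieModule.toEnd k L V f =
      LieModule.toEnd k L V f * LieModule.toEnd k L V e + LieModule.toEnd k L V h := by
    ext w
    simp [← hef]
  have hHF : LieModule.toEnd k L V h * LieModule.toEnd k L V f =
      LieModule.toEnd k L V f * LieModule.toEnd k L V h - (2 : k) • LieModule.toEnd k L V f := by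
    ext w
    have hw := leibniz_lie h f w
    rw [hf, smul_lie] at hw
    simp only [Module.End.mul_apply, LieModule.toEnd_apply_apply, LinearMap.sub_apply,
      LinearMap.smul_apply, hw]
    module
  induction n generalizing v with
  | zero => simpa using hvf
  | succ n ih =>
    rw [List.range_succ, List.map_append, List.prod_append, List.map_singleton,
      List.prod_singleton, Module.End.mul_apply]
    have hHv : ⁅e, ⁅h, v⁆⁆ = 0 := by
      rw [leibniz_lie, hv, lie_zero, add_zero, ← lie_skew, he, neg_lie, smul_lie, hv, smul_zero,
        neg_zero]
    refine ih _ (by simp [hv, hHv]) ?_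
    have key := LinearMap.congr_fun (sl2_mul_pow_succ (k := k) hEF hHF n) v
    rw [Module.End.mul_apply, hvf, map_zero, LinearMap.add_apply, Module.End.mul_apply,
      LieModule.toEnd_apply_apply, hv, map_zero, zero_add, LinearMap.smul_apply,
      Module.End.mul_apply] at key
    exact (smul_eq_zero.mp key.symm).resolve_left (Nat.cast_add_one_ne_zero n)
end

section
/- Let L be a nonzero finite-dimensional complex vector space and let Λ be a continuous group homomorphism from SL(2, ℝ) to the group of linear automorphisms of L. Then there exists a nonzero vector ξ ∈ L such that either (a) Λ(diag(t, t⁻¹)) ξ = ξ for all t ∈ ℝ, t ≠ 0, and Λ(w) ξ is proportional to ξ (i.e. there exists c ∈ ℂ with Λ(w) ξ = c ξ), where w is the matrix with rows (0, 1) and (−1, 0); or (b) Λ(diag(t, t⁻¹)) ξ = t ξ for all t ∈ ℝ, t ≠ 0. -/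
/-- The canonical topology on `SL(2, ℝ)`, induced from the space of matrices. -/
instance : TopologicalSpace (Matrix.SpecialLinearGroup (Fin 2) ℝ) :=
  TopologicalSpace.induced (fun A => (A : Matrix (Fin 2) (Fin 2) ℝ)) inferInstance

open NormedSpace Filter Topology

section BanachAlgebra

variable {A : Type*} [NormedRing A] [CompleteSpace A]

theorem exp_neg_mul_exp [NormedAlgebra ℝ A] (X : A) : exp (-X) * exp X = 1 := by
  let _ : NormedAlgebra ℚ A := .restrictScalars ℚ ℝ A
  rw [← exp_add_of_commute (by simp [Commute, SemiconjBy])]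
  simp

/-- A continuous one-parameter semigroup in a Banach algebra is an exponential. -/
theorem exists_eq_exp_smul_of_continuous [NormedAlgebra ℝ A] {f : ℝ → A} (hf : Continuous f)
    (h0 : f 0 = 1) (hadd : ∀ s t, f (s + t) = f s * f t) :
    ∃ X : A, ∀ t : ℝ, f t = exp (t • X) := by
  have hΦ (u : ℝ) : HasDerivAt (fun u => ∫ x in (0 : ℝ)..u, f x) (f u) u :=
    hf.integral_hasStrictDerivAt 0 u |>.hasDerivAt
  obtain ⟨c, hc⟩ : ∃ c : ℝ, IsUnit (c⁻¹ • ∫ x in (0 : ℝ)..c, f x) := by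
    have h := (hasDerivAt_iff_tendsto_slope.1 (hΦ 0)).eventually
      (Units.isOpen.mem_nhds (show IsUnit (f 0) by rw [h0]; exact isUnit_one))
    obtain ⟨c, hc⟩ := h.exists
    exact ⟨c, by simpa [slope_def_module] using hc⟩
  obtain ⟨Z, hZ⟩ := hc.exists_right_inv
  have hshift (t : ℝ) : f t = c⁻¹ • ((∫ x in (0 : ℝ)..(t + c), f x) - ∫ x in (0 : ℝ)..t, f x) * Z := by
    rw [intervalIntegral.integral_interval_sub_left (hf.intervalIntegrable _ _)
      (hf.intervalIntegrable _ _)]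
    have : ∫ x in t..(t + c), f x = f t * ∫ x in (0 : ℝ)..c, f x := by
      have h := (ContinuousLinearMap.mul ℝ A (f t)).intervalIntegral_comp_comm
        (hf.intervalIntegrable (μ := MeasureTheory.volume) 0 c)
      simp only [ContinuousLinearMap.mul_apply', ← hadd] at h
      rw [← h, intervalIntegral.integral_comp_add_left]
      simp
    rw [this, ← mul_smul_comm, mul_assoc, hZ, mul_one]
  obtain ⟨X, hX⟩ : ∃ X, HasDerivAt f X 0 := by
    rw [funext hshift]
    exact ⟨_, ((((hΦ (0 + c)).comp_add_const 0 c).sub (hΦ 0)).const_smul c⁻¹).mul_const Z⟩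
  have hf' (t : ℝ) : HasDerivAt f (f t * X) t := by
    have h : HasDerivAt (fun s => f t * f (s - t)) (f t * X) t :=
      HasDerivAt.const_mul _ (HasDerivAt.comp_sub_const t t (by simpa using hX))
    simpa [← hadd] using h
  refine ⟨X, fun t => ?_⟩
  have hg (t : ℝ) : HasDerivAt (fun s => f s * exp (s • -X)) 0 t := by
    refine ((hf' t).mul (hasDerivAt_exp_smul_const' (-X) t)).congr_deriv ?_
    noncomm_ring
  have hconst := is_const_of_deriv_eq_zero (fun s => (hg s).differentiableAt)
    (fun s => (hg s).deriv) t 0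
  simp only [h0, zero_smul, exp_zero, mul_one] at hconst
  calc f t = f t * exp (t • -X) * exp (t • X) := by rw [mul_assoc, smul_neg, exp_neg_mul_exp, mul_one]
    _ = _ := by rw [hconst, one_mul]

/-- If `Y` solves `Y' = [Y, E]`, then `exp (tE) Y(t) = Y(0) exp (tE)`. -/
theorem exp_smul_mul_eq_of_hasDerivAt [NormedAlgebra ℂ A] {E : A} {Y : ℂ → A}
    (hY : ∀ t, HasDerivAt Y (Y t * E - E * Y t) t) (t : ℂ) :
    exp (t • E) * Y t = Y 0 * exp (t • E) := by
  have hg (t : ℂ) : HasDerivAt (fun s => exp (s • E) * Y s * exp (s • -E)) 0 t := by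
    refine (((hasDerivAt_exp_smul_const E t).mul (hY t)).mul
      (hasDerivAt_exp_smul_const' (-E) t)).congr_deriv ?_
    simp only [Pi.mul_apply]
    noncomm_ring
  have hconst := is_const_of_deriv_eq_zero (fun s => (hg s).differentiableAt)
    (fun s => (hg s).deriv) t 0
  simp only [zero_smul, exp_zero, mul_one, one_mul] at hconst
  rw [← hconst, mul_assoc, smul_neg, exp_neg_mul_exp, mul_one]

/-- For an `sl₂`-triple in a complex Banach algebra, the elements `iH` and `E - F` have the same
exponential after scaling by `π`. -/
theorem exp_pi_smul_eq [NormedAlgebra ℂ A] {H E F : A} (hHE : H * E - E * H = (2 : ℂ) • E)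
    (hHF : H * F - F * H = (-2 : ℂ) • F) (hEF : E * F - F * E = H) :
    exp ((Real.pi : ℂ) • (E - F)) = exp ((Real.pi * Complex.I : ℂ) • H) := by
  let _ : NormedAlgebra ℚ A := .restrictScalars ℚ ℂ A
  set T := exp ((Real.pi * Complex.I : ℂ) • H) with hT
  have hcomm {X : A} {m : ℤ} (hX : H * X - X * H = (2 * m : ℂ) • X) : Commute T X := by
    have hY (t : ℂ) : HasDerivAt (fun s : ℂ => Complex.exp (-(2 * m) * s) • X)
        ((Complex.exp (-(2 * m) * t) • X) * H - H * (Complex.exp (-(2 * m) * t) • X)) t := by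
      have h := (((hasDerivAt_id t).const_mul (-(2 * m : ℂ))).cexp).smul_const X
      refine h.congr_deriv ?_
      rw [smul_mul_assoc, mul_smul_comm, ← smul_sub, ← neg_sub, hX, mul_one, id,
        mul_smul, ← neg_smul]
    have h := exp_smul_mul_eq_of_hasDerivAt hY (Real.pi * Complex.I)
    have h1 : Complex.exp (-(2 * m) * (Real.pi * Complex.I)) = 1 := by
      rw [Complex.exp_eq_one_iff]
      exact ⟨-m, by push_cast; ring⟩
    simp only [h1, one_smul, mul_zero, Complex.exp_zero] at h
    exact h
  have hTE : Commute T E := hcomm (m := 1) (by simpa using hHE)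
  have hTF : Commute T F := hcomm (m := -1) (by simpa using hHF)
  have hE₁ := exp_smul_mul_eq_of_hasDerivAt (E := E) (Y := fun a => H + (2 * a) • E)
    (fun t => by
      have h := ((((hasDerivAt_id t).const_mul (2 : ℂ))).smul_const E).const_add H
      refine h.congr_deriv ?_
      simp only [add_mul, mul_add, smul_mul_assoc, mul_smul_comm, mul_one]
      rw [← hHE]; abel) (-Complex.I)
  have hE₂ := exp_smul_mul_eq_of_hasDerivAt (E := E) (Y := fun a => F - a • H - (a ^ 2) • E)
    (fun t => by
      have h := (((hasDerivAt_id t).smul_const H).const_sub F).sub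
        ((hasDerivAt_pow 2 t).smul_const E)
      refine h.congr_deriv ?_
      simp only [sub_mul, mul_sub, smul_mul_assoc, mul_smul_comm]
      have h1 : E * F = H + F * E := by rw [← hEF]; abel
      have h2 : H * E = (2 : ℂ) • E + E * H := by rw [← hHE]; abel
      rw [h1, h2]
      simp
      module) (-Complex.I)
  have hF := exp_smul_mul_eq_of_hasDerivAt (E := F) (Y := fun b => H - (2 * b) • F)
    (fun t => by
      have h := ((((hasDerivAt_id t).const_mul (2 : ℂ))).smul_const F).const_sub H
      refine h.congr_deriv ?_
      simp only [sub_mul, mul_sub, smul_mul_assoc, mul_smul_comm, mul_one]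
      have h2 : H * F = (-2 : ℂ) • F + F * H := by rw [← hHF]; abel
      rw [h2]
      module) (-Complex.I / 2)
  set g₁ := exp (-Complex.I • E)
  set g₂ := exp ((-Complex.I / 2) • F)
  have hI : (-Complex.I) ^ 2 = -1 := by simp
  have hconj : (Complex.I • H) * (g₂ * g₁) = g₂ * g₁ * (E - F) := by
    rw [hI] at hE₂
    simp only [mul_zero, zero_smul, add_zero, sub_zero, ne_eq, OfNat.ofNat_ne_zero,
      not_false_eq_true, zero_pow] at hE₁ hE₂ hF
    have h1 : (H - (2 * (-Complex.I / 2)) • F) * g₁ = g₁ * (-Complex.I • (E - F)) := by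
      rw [sub_mul, smul_mul_assoc, ← hE₁, ← hE₂, ← mul_smul_comm, ← mul_sub]
      congr 1
      match_scalars <;> ring_nf <;> simp
    rw [smul_mul_assoc, ← mul_assoc, ← hF, mul_assoc, h1, ← mul_assoc, mul_smul_comm, smul_smul]
    simp
  obtain ⟨g, hg⟩ : IsUnit (g₂ * g₁) := (isUnit_exp _).mul (isUnit_exp _)
  have hTg : Commute T (g : A) := by
    rw [hg]
    exact ((hTF.smul_right _).exp_right).mul_right ((hTE.smul_right _).exp_right)
  rw [← hg] at hconj
  have h1 : (Real.pi : ℂ) • (E - F) = ↑g⁻¹ * ((Real.pi * Complex.I : ℂ) • H) * g := by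
    rw [mul_smul, mul_assoc, smul_mul_assoc, hconj, mul_smul_comm, Units.inv_mul_cancel_left]
  rw [h1, exp_units_conj', ← hT, mul_assoc, hTg.eq, Units.inv_mul_cancel_left]

end BanachAlgebra

section SpecialLinearGroup

local notation "SL₂ℝ" => Matrix.SpecialLinearGroup (Fin 2) ℝ

/-- The upper triangular unipotent one-parameter subgroup of `SL(2, ℝ)`. -/
def upperUnipotent (x : ℝ) : SL₂ℝ := ⟨!![1, x; 0, 1], by simp⟩

/-- The lower triangular unipotent one-parameter subgroup of `SL(2, ℝ)`. -/
def lowerUnipotent (y : ℝ) : SL₂ℝ := ⟨!![1, 0; y, 1], by simp⟩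

/-- The split torus one-parameter subgroup of `SL(2, ℝ)`. -/
noncomputable def expDiagonal (s : ℝ) : SL₂ℝ :=
  ⟨!![Real.exp s, 0; 0, Real.exp (-s)], by simp [← Real.exp_add]⟩

/-- The rotation subgroup of `SL(2, ℝ)`. -/
noncomputable def rotationSL (θ : ℝ) : SL₂ℝ :=
  ⟨!![Real.cos θ, Real.sin θ; -Real.sin θ, Real.cos θ], by
    simp [Matrix.det_fin_two, ← sq]⟩

theorem coe_upperUnipotent (x : ℝ) :
    (upperUnipotent x : Matrix (Fin 2) (Fin 2) ℝ) = !![1, x; 0, 1] := rfl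

theorem upperUnipotent_add (x y : ℝ) :
    upperUnipotent (x + y) = upperUnipotent x * upperUnipotent y := by
  apply Subtype.ext
  rw [Matrix.SpecialLinearGroup.coe_mul]
  ext i j
  fin_cases i <;> fin_cases j <;> simp [coe_upperUnipotent, add_comm]

theorem coe_lowerUnipotent (x : ℝ) :
    (lowerUnipotent x : Matrix (Fin 2) (Fin 2) ℝ) = !![1, 0; x, 1] := rfl

theorem lowerUnipotent_add (x y : ℝ) :
    lowerUnipotent (x + y) = lowerUnipotent x * lowerUnipotent y := by
  apply Subtype.ext
  rw [Matrix.SpecialLinearGroup.coe_mul]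
  ext i j
  fin_cases i <;> fin_cases j <;> simp [coe_lowerUnipotent]

theorem coe_expDiagonal (x : ℝ) :
    (expDiagonal x : Matrix (Fin 2) (Fin 2) ℝ) = !![Real.exp x, 0; 0, Real.exp (-x)] := rfl

theorem expDiagonal_add (x y : ℝ) :
    expDiagonal (x + y) = expDiagonal x * expDiagonal y := by
  apply Subtype.ext
  rw [Matrix.SpecialLinearGroup.coe_mul]
  ext i j
  fin_cases i <;> fin_cases j <;> simp [coe_expDiagonal, Real.exp_add, mul_comm]

theorem coe_rotationSL (x : ℝ) :
    (rotationSL x : Matrix (Fin 2) (Fin 2) ℝ) = !![Real.cos x, Real.sin x; -Real.sin x, Real.cos x] := rfl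

theorem rotationSL_add (x y : ℝ) : rotationSL (x + y) = rotationSL x * rotationSL y := by
  apply Subtype.ext
  rw [Matrix.SpecialLinearGroup.coe_mul]
  ext i j
  fin_cases i <;> fin_cases j <;> simp [coe_rotationSL, Real.cos_add, Real.sin_add] <;> ring

theorem upperUnipotent_zero : upperUnipotent 0 = 1 := by
  ext i j
  fin_cases i <;> fin_cases j <;> simp [upperUnipotent]

theorem lowerUnipotent_zero : lowerUnipotent 0 = 1 := by
  ext i j
  fin_cases i <;> fin_cases j <;> simp [lowerUnipotent]

theorem expDiagonal_zero : expDiagonal 0 = 1 := by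
  ext i j
  fin_cases i <;> fin_cases j <;> simp [expDiagonal]

theorem rotationSL_zero : rotationSL 0 = 1 := by
  ext i j
  fin_cases i <;> fin_cases j <;> simp [rotationSL]

/-- Continuity of a curve in `SL(2, ℝ)` can be checked on entries. -/
theorem continuous_SL_of_entries {g : ℝ → SL₂ℝ} (h : ∀ i j, Continuous fun t => g t i j) :
    Continuous g :=
  continuous_induced_rng.2 (continuous_matrix h)

theorem continuous_upperUnipotent : Continuous upperUnipotent :=
  continuous_SL_of_entries fun i j => by
    fin_cases i <;> fin_cases j <;> simp [upperUnipotent] <;> fun_prop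

theorem continuous_lowerUnipotent : Continuous lowerUnipotent :=
  continuous_SL_of_entries fun i j => by
    fin_cases i <;> fin_cases j <;> simp [lowerUnipotent] <;> fun_prop

theorem continuous_expDiagonal : Continuous expDiagonal :=
  continuous_SL_of_entries fun i j => by
    fin_cases i <;> fin_cases j <;> simp [expDiagonal] <;> fun_prop

theorem continuous_rotationSL : Continuous rotationSL :=
  continuous_SL_of_entries fun i j => by
    fin_cases i <;> fin_cases j <;> simp [rotationSL] <;> fun_prop

/-- The Gauss decomposition of a matrix in `SL(2, ℝ)` with positive upper left entry. -/
theorem eq_lowerUnipotent_mul_expDiagonal_mul_upperUnipotent {g : SL₂ℝ} (hg : 0 < g 0 0) :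
    g = lowerUnipotent (g 1 0 / g 0 0) * expDiagonal (Real.log (g 0 0)) *
      upperUnipotent (g 0 1 / g 0 0) := by
  have hdet := g.det_coe
  rw [Matrix.det_fin_two] at hdet
  apply Subtype.ext
  rw [Matrix.SpecialLinearGroup.coe_mul, Matrix.SpecialLinearGroup.coe_mul]
  ext i j
  fin_cases i <;> fin_cases j <;>
    simp [coe_lowerUnipotent, coe_expDiagonal, coe_upperUnipotent, Real.exp_log hg,
      Real.exp_neg] <;> field_simp
  linarith

variable {A : Type*} [NormedRing A] [CompleteSpace A] [NormedAlgebra ℂ A]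

/-- A continuous representation of `SL(2, ℝ)` in a complex Banach algebra differentiates to an
`sl₂`-triple, and maps `-1` to `exp (iπH)`. -/
theorem exists_infinitesimal_generators (ρ : SL₂ℝ →* A) (hρ : Continuous ρ) :
    ∃ H E F : A, H * E - E * H = (2 : ℂ) • E ∧ H * F - F * H = (-2 : ℂ) • F ∧
      E * F - F * E = H ∧ (∀ s : ℝ, ρ (expDiagonal s) = exp ((s : ℂ) • H)) ∧
      ρ (rotationSL Real.pi) = exp ((Real.pi * Complex.I : ℂ) • H) := by
  obtain ⟨E, hE⟩ := exists_eq_exp_smul_of_continuous (hρ.comp continuous_upperUnipotent)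
    (by simp [upperUnipotent_zero]) (by simp [upperUnipotent_add])
  obtain ⟨F, hF⟩ := exists_eq_exp_smul_of_continuous (hρ.comp continuous_lowerUnipotent)
    (by simp [lowerUnipotent_zero]) (by simp [lowerUnipotent_add])
  obtain ⟨H, hH⟩ := exists_eq_exp_smul_of_continuous (hρ.comp continuous_expDiagonal)
    (by simp [expDiagonal_zero]) (by simp [expDiagonal_add])
  obtain ⟨R, hR⟩ := exists_eq_exp_smul_of_continuous (hρ.comp continuous_rotationSL)
    (by simp [rotationSL_zero]) (by simp [rotationSL_add])
  simp only [Function.comp_apply] at hE hF hH hR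
  have hexp (X : A) : HasDerivAt (fun s : ℝ => exp (s • X)) X 0 := by
    simpa using hasDerivAt_exp_smul_const (𝕂 := ℝ) X 0
  have hcurve {g : ℝ → SL₂ℝ} {a b c : ℝ} (h0 : g 0 = 1) (ha : HasDerivAt (fun s => g s 0 0) a 0)
      (hb : HasDerivAt (fun s => g s 0 1) b 0) (hc : HasDerivAt (fun s => g s 1 0) c 0) :
      HasDerivAt (fun s => ρ (g s)) (a • H + b • E + c • F) 0 := by
    have h00 : g 0 0 0 = 1 := by simp [h0]
    have h01 : g 0 0 1 = 0 := by simp [h0]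
    have h10 : g 0 1 0 = 0 := by simp [h0]
    have hev : ∀ᶠ s in 𝓝 0, ρ (g s) = exp ((g s 1 0 / g s 0 0) • F) *
        exp (Real.log (g s 0 0) • H) * exp ((g s 0 1 / g s 0 0) • E) := by
      filter_upwards [ha.continuousAt.eventually_const_lt (show 0 < g 0 0 0 by simp [h00])]
        with s hs
      conv_lhs => rw [eq_lowerUnipotent_mul_expDiagonal_mul_upperUnipotent hs]
      rw [map_mul, map_mul, hE, hF, hH]
    have hF' := (show HasDerivAt (fun s : ℝ => exp (s • F)) F (g 0 1 0 / g 0 0 0) by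
      simpa [h10] using hexp F).scomp 0 (hc.div ha (by simp [h00]))
    have hE' := (show HasDerivAt (fun s : ℝ => exp (s • E)) E (g 0 0 1 / g 0 0 0) by
      simpa [h01] using hexp E).scomp 0 (hb.div ha (by simp [h00]))
    have hH' := (show HasDerivAt (fun s : ℝ => exp (s • H)) H (Real.log (g 0 0 0)) by
      simpa [h00] using hexp H).scomp 0 (ha.log (by simp [h00]))
    refine (((hF'.mul hH').mul hE').congr_of_eventuallyEq hev).congr_deriv ?_
    simp [h00, h01, h10]
    abel
  have hconjE (s : ℝ) : ρ (expDiagonal s) * E * ρ (expDiagonal (-s)) = Real.exp (2 * s) • E := by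
    have hg (x : ℝ) : ((expDiagonal s * upperUnipotent x * expDiagonal (-s) : SL₂ℝ) :
        Matrix (Fin 2) (Fin 2) ℝ) = !![1, Real.exp (2 * s) * x; 0, 1] := by
      simp only [Matrix.SpecialLinearGroup.coe_mul, coe_expDiagonal, coe_upperUnipotent]
      ext i j
      fin_cases i <;> fin_cases j <;> simp [two_mul, Real.exp_add, Real.exp_neg]
      ring
    have h1 := ((hexp E).const_mul (ρ (expDiagonal s))).mul_const (ρ (expDiagonal (-s)))
    have h2 := hcurve (g := fun x => expDiagonal s * upperUnipotent x * expDiagonal (-s))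
      (a := 0) (b := Real.exp (2 * s)) (c := 0)
      (by simp [upperUnipotent_zero, ← expDiagonal_add, expDiagonal_zero])
      (by simpa [hg] using hasDerivAt_const (0 : ℝ) (1 : ℝ))
      (by simpa [hg] using (hasDerivAt_id (0 : ℝ)).const_mul (Real.exp (2 * s)))
      (by simpa [hg] using hasDerivAt_const (0 : ℝ) (0 : ℝ))
    simp only [map_mul, hE] at h2
    simpa using h1.unique h2
  have hconjF (s : ℝ) : ρ (expDiagonal s) * F * ρ (expDiagonal (-s)) = Real.exp (-2 * s) • F := by
    have hg (x : ℝ) : ((expDiagonal s * lowerUnipotent x * expDiagonal (-s) : SL₂ℝ) :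
        Matrix (Fin 2) (Fin 2) ℝ) = !![1, 0; Real.exp (-2 * s) * x, 1] := by
      have h2s : -2 * s = -s + -s := by ring
      simp only [Matrix.SpecialLinearGroup.coe_mul, coe_expDiagonal, coe_lowerUnipotent]
      ext i j
      fin_cases i <;> fin_cases j <;> simp [h2s, Real.exp_add, Real.exp_neg]
      ring
    have h1 := ((hexp F).const_mul (ρ (expDiagonal s))).mul_const (ρ (expDiagonal (-s)))
    have h2 := hcurve (g := fun x => expDiagonal s * lowerUnipotent x * expDiagonal (-s))
      (a := 0) (b := 0) (c := Real.exp (-2 * s))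
      (by simp [lowerUnipotent_zero, ← expDiagonal_add, expDiagonal_zero])
      (by simpa [hg] using hasDerivAt_const (0 : ℝ) (1 : ℝ))
      (by simpa [hg] using hasDerivAt_const (0 : ℝ) (0 : ℝ))
      (by simpa [hg] using (hasDerivAt_id (0 : ℝ)).const_mul (Real.exp (-2 * s)))
    simp only [map_mul, hF] at h2
    simpa using h1.unique h2
  have hconjU (x : ℝ) : ρ (upperUnipotent x) * F * ρ (upperUnipotent (-x)) =
      F + x • H - x ^ 2 • E := by
    have hg (y : ℝ) : ((upperUnipotent x * lowerUnipotent y * upperUnipotent (-x) : SL₂ℝ) :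
        Matrix (Fin 2) (Fin 2) ℝ) = !![1 + x * y, -x ^ 2 * y; y, 1 - x * y] := by
      simp only [Matrix.SpecialLinearGroup.coe_mul, coe_upperUnipotent, coe_lowerUnipotent]
      ext i j
      fin_cases i <;> fin_cases j <;> simp <;> ring
    have h1 := ((hexp F).const_mul (ρ (upperUnipotent x))).mul_const (ρ (upperUnipotent (-x)))
    have h2 := hcurve (g := fun y => upperUnipotent x * lowerUnipotent y * upperUnipotent (-x))
      (a := x) (b := -x ^ 2) (c := 1)
      (by simp [lowerUnipotent_zero, ← upperUnipotent_add, upperUnipotent_zero])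
      (by simpa [hg] using ((hasDerivAt_id (0 : ℝ)).const_mul x).const_add 1)
      (by simpa [hg] using (hasDerivAt_id (0 : ℝ)).const_mul (-x ^ 2))
      (by simpa [hg] using hasDerivAt_id' (0 : ℝ))
    simp only [map_mul, hF] at h2
    rw [h1.unique h2]
    module
  have hR' : R = E - F := by
    have h1 := hcurve (g := rotationSL) (a := 0) (b := 1) (c := -1) rotationSL_zero ?_ ?_ ?_
    · simp only [hR] at h1
      rw [(hexp R).unique h1]
      module
    · simpa [rotationSL] using Real.hasDerivAt_cos 0
    · simpa [rotationSL] using Real.hasDerivAt_sin 0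
    · simpa [rotationSL] using (Real.hasDerivAt_sin 0).fun_neg
  have hexpneg (X : A) : HasDerivAt (fun s : ℝ => exp (-s • X)) (-X) 0 := by
    simpa using hexp (-X)
  have hHE : H * E - E * H = (2 : ℂ) • E := by
    have h1 := ((hexp H).mul_const E).mul (hexpneg H)
    have h2 : HasDerivAt (fun s : ℝ => Real.exp (2 * s) • E) ((2 : ℝ) • E) 0 := by
      simpa using (((hasDerivAt_id (0 : ℝ)).const_mul 2).exp).smul_const E
    simp only [← hconjE, hH] at h2
    have h := h1.unique h2
    simp only [zero_smul, neg_zero, exp_zero, mul_one, one_mul] at h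
    rw [sub_eq_add_neg, ← mul_neg, h]
    norm_cast
  have hHF : H * F - F * H = (-2 : ℂ) • F := by
    have h1 := ((hexp H).mul_const F).mul (hexpneg H)
    have h2 : HasDerivAt (fun s : ℝ => Real.exp (-2 * s) • F) ((-2 : ℝ) • F) 0 := by
      simpa using (((hasDerivAt_id (0 : ℝ)).const_mul (-2)).exp).smul_const F
    simp only [← hconjF, hH] at h2
    have h := h1.unique h2
    simp only [zero_smul, neg_zero, exp_zero, mul_one, one_mul] at h
    rw [sub_eq_add_neg, ← mul_neg, h]
    norm_cast
  have hEF : E * F - F * E = H := by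
    have h1 := ((hexp E).mul_const F).mul (hexpneg E)
    have h2 : HasDerivAt (fun x : ℝ => F + x • H - x ^ 2 • E) H 0 := by
      simpa using (((hasDerivAt_id (0 : ℝ)).smul_const H).const_add F).fun_sub
        ((hasDerivAt_pow 2 (0 : ℝ)).smul_const E)
    simp only [← hconjU, hE] at h2
    have h := h1.unique h2
    simp only [zero_smul, neg_zero, exp_zero, mul_one, one_mul] at h
    rw [sub_eq_add_neg, ← mul_neg, h]
  refine ⟨H, E, F, hHE, hHF, hEF, fun s => ?_, ?_⟩
  · rw [hH, Complex.coe_smul]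
  · rw [hR, hR', ← exp_pi_smul_eq hHE hHF hEF, Complex.coe_smul]

end SpecialLinearGroup

/-- Operators on a nonzero finite-dimensional complex vector space satisfying the `sl₂` relations
have a nonzero vector of weight zero or one. -/
theorem exists_weight_zero_or_one {V : Type*} [AddCommGroup V] [Module ℂ V]
    [FiniteDimensional ℂ V] [Nontrivial V] {H E F : Module.End ℂ V}
    (hHE : H * E - E * H = (2 : ℂ) • E) (hHF : H * F - F * H = (-2 : ℂ) • F)
    (hEF : E * F - F * E = H) : ∃ ξ : V, ξ ≠ 0 ∧ (H ξ = 0 ∨ H ξ = ξ) := by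
  let _ : LieRing (Module.End ℂ V) := LieRing.ofAssociativeRing
  by_cases hH : H = 0
  · obtain ⟨ξ, hξ⟩ := exists_ne (0 : V)
    exact ⟨ξ, hξ, .inl (by simp [hH])⟩
  have t : IsSl2Triple H E F :=
    ⟨hH, hEF, hHE.trans (by module), hHF.trans (by module)⟩
  obtain ⟨μ, m, -, hm⟩ := t.exists_hasPrimitiveVectorWith (R := ℂ) (M := V)
  obtain ⟨n, hn⟩ := hm.exists_nat
  refine ⟨_, hm.pow_toEnd_f_ne_zero_of_eq_nat hn (Nat.div_le_self n 2), ?_⟩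
  have h := hm.lie_h_pow_toEnd_f (n / 2)
  rw [Module.End.lie_apply] at h
  rw [h, hn]
  rcases Nat.even_or_odd' n with ⟨k, rfl | rfl⟩
  · left; simp
  · right
    have : (2 * k + 1) / 2 = k := by omega
    simp [this]

theorem ContinuousLinearMap.exp_smul_apply_of_apply_eq_smul {V : Type*} [NormedAddCommGroup V]
    [NormedSpace ℂ V] [CompleteSpace V] {H : V →L[ℂ] V} {ξ : V} {μ : ℂ} (h : H ξ = μ • ξ) (z : ℂ) :
    exp (z • H) ξ = Complex.exp (z * μ) • ξ := by
  have hg (t : ℂ) : HasDerivAt (fun s => Complex.exp (-s * μ) • exp (s • H) ξ) 0 t := by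
    have h1 := (((hasDerivAt_neg t).mul_const μ).cexp)
    have h2 := (hasDerivAt_exp_smul_const H t).clm_apply (hasDerivAt_const t ξ)
    refine (h1.smul h2).congr_deriv ?_
    simp [h, smul_smul]
  have hconst := is_const_of_deriv_eq_zero (fun s => (hg s).differentiableAt)
    (fun s => (hg s).deriv) z 0
  simp only [neg_zero, zero_mul, Complex.exp_zero, zero_smul, exp_zero, one_smul,
    one_apply_eq_self] at hconst
  nth_rw 2 [← hconst]
  rw [smul_smul, ← Complex.exp_add]
  simp

/-- a continuous finite-dimensional representation of `SL(2, ℝ)` on a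
nonzero complex vector space has a nonzero vector `ξ` such that either
`Λ(diag(t, t⁻¹)) ξ = ξ` for all `t ≠ 0` and `Λ(w) ξ` is proportional to `ξ`, or
`Λ(diag(t, t⁻¹)) ξ = t ξ` for all `t ≠ 0`. -/
theorem stmt_15 {L : Type*} [NormedAddCommGroup L] [NormedSpace ℂ L]
    [FiniteDimensional ℂ L] [Nontrivial L]
    (Λ : Matrix.SpecialLinearGroup (Fin 2) ℝ →* (L →L[ℂ] L)ˣ)
    (hcont : Continuous fun A : Matrix.SpecialLinearGroup (Fin 2) ℝ => (Λ A : L →L[ℂ] L))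
    (d : ℝ → Matrix.SpecialLinearGroup (Fin 2) ℝ)
    (hd : ∀ t : ℝ, t ≠ 0 → (d t : Matrix (Fin 2) (Fin 2) ℝ) = !![t, 0; 0, t⁻¹])
    (w : Matrix.SpecialLinearGroup (Fin 2) ℝ)
    (hw : (w : Matrix (Fin 2) (Fin 2) ℝ) = !![0, 1; -1, 0]) :
    ∃ ξ : L, ξ ≠ 0 ∧
      (((∀ t : ℝ, t ≠ 0 → (Λ (d t) : L →L[ℂ] L) ξ = ξ) ∧
          ∃ c : ℂ, (Λ w : L →L[ℂ] L) ξ = c • ξ) ∨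
        (∀ t : ℝ, t ≠ 0 → (Λ (d t) : L →L[ℂ] L) ξ = (t : ℂ) • ξ)) := by
  have : CompleteSpace L := FiniteDimensional.complete ℂ L
  obtain ⟨H, E, F, hHE, hHF, hEF, hdiag, hrot⟩ :=
    exists_infinitesimal_generators ((Units.coeHom (L →L[ℂ] L)).comp Λ) hcont
  simp only [MonoidHom.comp_apply, Units.coeHom_apply] at hdiag hrot
  obtain ⟨ξ, hξ, hwt⟩ : ∃ ξ : L, ξ ≠ 0 ∧ (H ξ = 0 ∨ H ξ = ξ) :=
    exists_weight_zero_or_one (V := L) (H := (H : L →ₗ[ℂ] L)) (E := (E : L →ₗ[ℂ] L))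
      (F := (F : L →ₗ[ℂ] L))
      (congrArg ContinuousLinearMap.toLinearMap hHE)
      (congrArg ContinuousLinearMap.toLinearMap hHF)
      (congrArg ContinuousLinearMap.toLinearMap hEF)
  have hpos {t : ℝ} (ht : 0 < t) : d t = expDiagonal (Real.log t) := by
    apply Subtype.ext
    rw [hd t ht.ne']
    simp [expDiagonal, Real.exp_neg, Real.exp_log ht]
  have hneg {t : ℝ} (ht : t < 0) :
      d t = rotationSL Real.pi * expDiagonal (Real.log (-t)) := by
    apply Subtype.ext
    rw [hd t ht.ne]
    rw [Matrix.SpecialLinearGroup.coe_mul, coe_rotationSL, coe_expDiagonal, Real.exp_neg,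
      Real.exp_log (neg_pos.2 ht)]
    simp [inv_neg]
  have hweight {μ : ℂ} (hμ : H ξ = μ • ξ) {t : ℝ} (ht : t ≠ 0) :
      (Λ (d t) : L →L[ℂ] L) ξ = Complex.exp (Complex.log t * μ) • ξ := by
    rcases ht.lt_or_gt with ht | ht
    · rw [hneg ht, map_mul, Units.val_mul, hdiag, hrot, mul_apply_eq_comp,
        ContinuousLinearMap.exp_smul_apply_of_apply_eq_smul hμ, map_smul,
        ContinuousLinearMap.exp_smul_apply_of_apply_eq_smul hμ, smul_smul, ← Complex.exp_add]
      congr 2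
      rw [Complex.log, Complex.arg_ofReal_of_neg ht, Complex.norm_real, Real.norm_of_nonpos ht.le]
      ring
    · rw [hpos ht, hdiag, ContinuousLinearMap.exp_smul_apply_of_apply_eq_smul hμ,
        Complex.ofReal_log ht.le]
  rcases hwt with h0 | h1
  · let W : Submodule ℂ L :=
      ⨅ t : {t : ℝ // t ≠ 0}, Module.End.eigenspace ((Λ (d t) : L →L[ℂ] L) : L →ₗ[ℂ] L) 1
    have hW {v : L} : v ∈ W ↔ ∀ t : ℝ, t ≠ 0 → (Λ (d t) : L →L[ℂ] L) v = v := by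
      simp [W, Submodule.mem_iInf]
    have hξW : ξ ∈ W := hW.2 fun t ht => by simpa using hweight (μ := 0) (by simpa using h0) ht
    have hmaps : ∀ v ∈ W, ((Λ w : L →L[ℂ] L) : L →ₗ[ℂ] L) v ∈ W := by
      intro v hv
      refine hW.2 fun t ht => ?_
      have hcomm : d t * w = w * d t⁻¹ := by
        apply Subtype.ext
        simp [hd t ht, hd _ (inv_ne_zero ht), hw]
      have h := congrArg (fun g => (Λ g : L →L[ℂ] L) v) hcomm
      simpa [hW.1 hv _ (inv_ne_zero ht)] using h
    have : Nontrivial W := ⟨⟨ξ, hξW⟩, 0, by simpa using hξ⟩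
    obtain ⟨c, hc⟩ := Module.End.exists_eigenvalue (LinearMap.restrict _ hmaps)
    obtain ⟨v, hv⟩ := hc.exists_hasEigenvector
    refine ⟨v, by simpa using hv.2, .inl ⟨hW.1 v.2, c, ?_⟩⟩
    simpa using congrArg Subtype.val hv.apply_eq_smul
  · refine ⟨ξ, hξ, .inr fun t ht => ?_⟩
    rw [hweight (μ := 1) (by simpa using h1) ht, mul_one, Complex.exp_log (by simpa using ht)]
end
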